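/- Let Δ be a 2-dimensional simplicial complex on [n] over a field K. Then K[Δ] is canonically Cohen–Macaulay if and only if the Lyubeznik number λ_{2,3}(K[Δ]) = 0. -/

import Mathlib

open CategoryTheory Opposite MvPolynomial

/-- The Ext modules `Ext^i_R(M, N)`. -/
noncomputable def extMod (R : Type) [CommRing R] (i : ℕ) (M N : Type) [AddCommGroup M]
    [Module R M] [AddCommGroup N] [Module R N] : ModuleCat R :=
  ((Ext R (ModuleCat R) i).obj (op (ModuleCat.of R M))).obj (ModuleCat.of R N)

/-- The Krull dimension of a module: `dim M = dim R/Ann(M)`. -/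
noncomputable def moduleDim (R : Type) [CommRing R] (M : Type) [AddCommGroup M] [Module R M] :
    WithBot (WithTop ℕ) :=
  ringKrullDim (R ⧸ Module.annihilator R M)

/-- The depth of `M` with respect to the ideal `I`: the supremum of the lengths of
`M`-regular sequences contained in `I`. -/
noncomputable def moduleDepth {R : Type} [CommRing R] (I : Ideal R) (M : Type) [AddCommGroup M]
    [Module R M] : WithTop ℕ :=
  sSup {m : WithTop ℕ | ∃ rs : List R, (rs.length : WithTop ℕ) = m ∧ (∀ r ∈ rs, r ∈ I) ∧
    RingTheory.Sequence.IsRegular M rs}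

/-- `M` is a Cohen–Macaulay module (w.r.t. the distinguished ideal `I`): depth equals
Krull dimension. -/
def IsCMMod {R : Type} [CommRing R] (I : Ideal R) (M : Type) [AddCommGroup M] [Module R M] :
    Prop :=
  (moduleDepth I M : WithBot (WithTop ℕ)) = moduleDim R M

/-- The graded maximal ideal `𝔪 = (x₁, …, xₙ)` of `R = K[x₁,…,xₙ]`. -/
noncomputable def maxIdeal (K : Type) [Field K] (n : ℕ) : Ideal (MvPolynomial (Fin n) K) :=
  Ideal.span (Set.range (MvPolynomial.X : Fin n → MvPolynomial (Fin n) K))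

attribute [local instance] MvPolynomial.gradedAlgebra

open MvPolynomial

/-- `Δ` is an (abstract) simplicial complex on the vertex set `Fin n`:
a collection of finite sets closed under taking subsets. -/
def IsSimplicialComplex {n : ℕ} (Δ : Finset (Finset (Fin n))) : Prop :=
  ∀ s ∈ Δ, ∀ t ⊆ s, t ∈ Δ

/-- The Stanley–Reisner ideal `I_Δ` of `Δ`, generated by the squarefree monomials
corresponding to non-faces of `Δ`. -/
noncomputable def stanleyReisnerIdeal (K : Type) [Field K] {n : ℕ}
    (Δ : Finset (Finset (Fin n))) : Ideal (MvPolynomial (Fin n) K) :=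
  Ideal.span {m | ∃ S : Finset (Fin n), S ∉ Δ ∧ m = ∏ i ∈ S, (MvPolynomial.X i : MvPolynomial (Fin n) K)}

/-- The space of simplicial `k`-chains of `Δ` with coefficients in `K`:
functions on the `k`-dimensional faces (faces with `k+1` vertices). -/
abbrev simpChains (K : Type) [Field K] {n : ℕ} (Δ : Finset (Finset (Fin n))) (k : ℕ) : Type :=
  {s : Finset (Fin n) // s ∈ Δ ∧ s.card = k + 1} → K

/-- The simplicial boundary map `∂ : C_{k+1}(Δ; K) → C_k(Δ; K)`, with the standard signs
coming from the linear order on the vertices. -/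
noncomputable def simpBoundary (K : Type) [Field K] {n : ℕ} (Δ : Finset (Finset (Fin n)))
    (k : ℕ) : simpChains K Δ (k + 1) →ₗ[K] simpChains K Δ k where
  toFun c s := ∑ v : Fin n,
    if h : v ∉ s.1 ∧ insert v s.1 ∈ Δ ∧ (insert v s.1).card = (k + 1) + 1
      then ((-1 : K)) ^ ((s.1.filter (fun i => i < v)).card) * c ⟨insert v s.1, h.2⟩
      else 0
  map_add' c c' := by
    funext s
    rw [Pi.add_apply, ← Finset.sum_add_distrib]
    refine Finset.sum_congr rfl fun v _ => ?_
    split_ifs with h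
    · simp [mul_add]
    · simp
  map_smul' a c := by
    funext s
    simp only [RingHom.id_apply, Pi.smul_apply, Finset.smul_sum]
    refine Finset.sum_congr rfl fun v _ => ?_
    split_ifs with h
    · simp [smul_eq_mul]; ring
    · simp

/-- The reduced simplicial homology `H_{j+1}(Δ; K)` (for homological degrees `≥ 1`,
reduced and ordinary homology agree): cycles in degree `j+1` modulo boundaries. -/
noncomputable def simpHomologySucc (K : Type) [Field K] {n : ℕ} (Δ : Finset (Finset (Fin n)))
    (j : ℕ) : Type :=
  ↥(LinearMap.ker (simpBoundary K Δ j)) ⧸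
    Submodule.comap (LinearMap.ker (simpBoundary K Δ j)).subtype
      (LinearMap.range (simpBoundary K Δ (j + 1)))

namespace CanonicalCM

section Bridge

variable {R : Type} [CommRing R]

lemma extMk_eq_zero_iff_zero {X Y : ModuleCat.{0} R} (P : ProjectiveResolution X)
    (f : P.complex.X 0 ⟶ Y) (m : ℕ) (hm : 0 + 1 = m) (hf : P.complex.d m 0 ≫ f = 0) :
    P.extMk f m hm hf = 0 ↔ f = 0 := by
  simp only [← P.extEquivCohomologyClass.apply_eq_iff_eq,
    ProjectiveResolution.extEquivCohomologyClass_extMk,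
    ProjectiveResolution.extEquivCohomologyClass_zero,
    CochainComplex.HomComplex.CohomologyClass.mk_eq_zero_iff]
  rw [CochainComplex.HomComplex.Cocycle.toSingleMk_mem_coboundaries_iff _ _ _ _ _ 1 (by simp)]
  have h1 : Limits.IsZero (P.cochainComplex.X 1) :=
    P.cochainComplex.isZero_of_isStrictlyLE 0 1 (by simp)
  constructor
  · rintro ⟨g, hg⟩
    rw [h1.eq_of_src g 0] at hg
    rw [← cancel_epi (P.cochainComplexXIso (-(0:ℕ)) 0 rfl).hom]
    simpa using hg.symm
  · rintro rfl
    exact ⟨0, by simp⟩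

lemma smul_extMk {X Y : ModuleCat.{0} R} (P : ProjectiveResolution X) {n : ℕ} (r : R)
    (f : P.complex.X n ⟶ Y) (m : ℕ) (hm : n + 1 = m) (hf : P.complex.d m n ≫ f = 0) :
    r • P.extMk f m hm hf = P.extMk (r • f) m hm (by simp [hf]) := by
  rw [Abelian.Ext.smul_eq_comp_mk₀, P.extMk_comp_mk₀]
  congr 1

/-- The morphism `P_n ⟶ Y` underlying a cocycle of the complex `Hom(P, Y)`. -/
noncomputable def cocycleHom {X : ModuleCat.{0} R} (P : ProjectiveResolution X)
    (Y : ModuleCat.{0} R) (n : ℕ) :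
    (P.complex.linearYonedaObj R Y).cycles n →ₗ[R] (P.complex.X n ⟶ Y) :=
  ((P.complex.linearYonedaObj R Y).iCycles n).hom

lemma d_cocycleHom {X : ModuleCat.{0} R} (P : ProjectiveResolution X)
    (Y : ModuleCat.{0} R) (n : ℕ) (z) :
    P.complex.d (n + 1) n ≫ cocycleHom P Y n z = 0 :=
  congrArg (fun f => f.hom z) ((P.complex.linearYonedaObj R Y).iCycles_d n (n + 1))

/-- The class in `Ext` of a cocycle of the complex `Hom(P, Y)`. -/
noncomputable def cyclesToExt {X : ModuleCat.{0} R} (P : ProjectiveResolution X)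
    (Y : ModuleCat.{0} R) (n : ℕ) :
    (P.complex.linearYonedaObj R Y).cycles n →ₗ[R] Abelian.Ext X Y n where
  toFun z := P.extMk (cocycleHom P Y n z) (n + 1) rfl (d_cocycleHom P Y n z)
  map_add' x y := by
    simp only [map_add]
    rw [P.add_extMk]
  map_smul' r x := by
    simp only [map_smul]
    rw [RingHom.id_apply, smul_extMk]

lemma exists_iCycles_eq {C : CochainComplex (ModuleCat.{0} R) ℕ} (n : ℕ) (f : C.X n)
    (hf : C.d n (n + 1) f = 0) : ∃ z : C.cycles n, C.iCycles n z = f := by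
  let g : ModuleCat.of R R ⟶ C.X n := ModuleCat.ofHom (LinearMap.toSpanSingleton R _ f)
  have hg : g ≫ C.d n (n + 1) = 0 := by
    ext
    simpa [g] using hf
  refine ⟨C.liftCycles g (n + 1) (by simp) hg (1 : R), ?_⟩
  have := congrArg (fun h => h.hom (1 : R)) (C.liftCycles_i g (n + 1) (by simp) hg)
  exact this.trans (one_smul R f)

lemma homologyπ_eq_zero_iff {C : CochainComplex (ModuleCat.{0} R) ℕ} (n : ℕ) (z : C.cycles n) :
    C.homologyπ n z = 0 ↔
      ∃ y : C.X ((ComplexShape.up ℕ).prev n), C.toCycles _ n y = z := by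
  have hex : (ShortComplex.mk (C.toCycles ((ComplexShape.up ℕ).prev n) n) (C.homologyπ n)
    (C.toCycles_comp_homologyπ _ n)).Exact :=
    ShortComplex.exact_of_g_is_cokernel _ (C.homologyIsCokernel _ _ rfl)
  rw [ShortComplex.moduleCat_exact_iff] at hex
  constructor
  · exact hex z
  · rintro ⟨y, rfl⟩
    exact congrArg (fun h => h.hom y) (C.toCycles_comp_homologyπ ((ComplexShape.up ℕ).prev n) n)

lemma cyclesToExt_surjective {X : ModuleCat.{0} R} (P : ProjectiveResolution X)
    (Y : ModuleCat.{0} R) (n : ℕ) : Function.Surjective (cyclesToExt P Y n) := by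
  intro α
  obtain ⟨f, hf, rfl⟩ := P.extMk_surjective α (n + 1) rfl
  obtain ⟨z, hz⟩ := exists_iCycles_eq (C := P.complex.linearYonedaObj R Y) n f hf
  have hz' : cocycleHom P Y n z = f := hz
  refine ⟨z, ?_⟩
  simp only [cyclesToExt, LinearMap.coe_mk, AddHom.coe_mk, hz']

lemma iCycles_injective (C : CochainComplex (ModuleCat.{0} R) ℕ) (n : ℕ) :
    Function.Injective (C.iCycles n) :=
  (ModuleCat.mono_iff_injective _).1 inferInstance

lemma cyclesToExt_eq_zero_iff {X : ModuleCat.{0} R} (P : ProjectiveResolution X)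
    (Y : ModuleCat.{0} R) (n : ℕ) (z) :
    cyclesToExt P Y n z = 0 ↔ (P.complex.linearYonedaObj R Y).homologyπ n z = 0 := by
  have key : ∀ y, (P.complex.linearYonedaObj R Y).toCycles
      ((ComplexShape.up ℕ).prev n) n y = z ↔
      P.complex.d n ((ComplexShape.up ℕ).prev n) ≫ y = cocycleHom P Y n z := by
    intro y
    rw [← (iCycles_injective _ n).eq_iff]
    have := congrArg (fun h => h.hom y)
      ((P.complex.linearYonedaObj R Y).toCycles_i ((ComplexShape.up ℕ).prev n) n)
    exact Eq.congr_left this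
  rw [homologyπ_eq_zero_iff]
  refine Iff.trans ?_ (exists_congr key).symm
  simp only [cyclesToExt, LinearMap.coe_mk, AddHom.coe_mk]
  cases n with
  | zero =>
    rw [extMk_eq_zero_iff_zero, P.complex.shape _ _ (by simp)]
    exact ⟨fun h => ⟨0, by rw [h]; exact Limits.zero_comp⟩,
      fun ⟨a, ha⟩ => ha.symm.trans Limits.zero_comp⟩
  | succ m =>
    rw [P.extMk_eq_zero_iff _ _ _ _ m rfl]
    have : (ComplexShape.up ℕ).prev (m + 1) = m := by simp
    rw [this]
    exact Iff.rfl

noncomputable def extModEquiv (N L : Type) [AddCommGroup N] [Module R N] [AddCommGroup L]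
    [Module R L] (i : ℕ) :
    extMod R i N L ≃ₗ[R] Abelian.Ext (ModuleCat.of R N) (ModuleCat.of R L) i := by
  let P := projectiveResolution (ModuleCat.of R N)
  let C := P.complex.linearYonedaObj R (ModuleCat.of R L)
  let e₁ : extMod R i N L ≃ₗ[R] C.homology i := (P.isoExt (R := R) i _).toLinearEquiv
  have hs : Function.Surjective (C.homologyπ i).hom :=
    (ModuleCat.epi_iff_surjective (C.homologyπ i)).1 inferInstance
  let e₂ := LinearMap.quotKerEquivOfSurjective _ hs
  let e₃ := LinearMap.quotKerEquivOfSurjective _ (cyclesToExt_surjective P (ModuleCat.of R L) i)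
  have hk : LinearMap.ker (C.homologyπ i).hom =
      LinearMap.ker (cyclesToExt P (ModuleCat.of R L) i) := by
    ext z
    exact (cyclesToExt_eq_zero_iff P _ i z).symm
  exact e₁ ≪≫ₗ e₂.symm ≪≫ₗ Submodule.quotEquivOfEq _ _ hk ≪≫ₗ e₃

end Bridge

section ModuleExt

variable (R : Type) [CommRing R]

/-- The module `Ext^i_R(N, L)` of the abelian category of `R`-modules. -/
abbrev ExtM (N L : Type) [AddCommGroup N] [Module R N] [AddCommGroup L] [Module R L] (i : ℕ) :
    Type :=
  Abelian.Ext (ModuleCat.of R N) (ModuleCat.of R L) i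

variable {R}
variable {A B C L L' L'' : Type} [AddCommGroup A] [Module R A] [AddCommGroup B] [Module R B]
  [AddCommGroup C] [Module R C] [AddCommGroup L] [Module R L] [AddCommGroup L'] [Module R L']
  [AddCommGroup L''] [Module R L'']

/-- A short exact sequence of modules. -/
structure IsSES (f : A →ₗ[R] B) (g : B →ₗ[R] C) : Prop where
  inj : Function.Injective f
  surj : Function.Surjective g
  exact : Function.Exact f g

/-- The short complex in the category of modules given by a short exact sequence. -/
abbrev IsSES.complex {f : A →ₗ[R] B} {g : B →ₗ[R] C} (h : IsSES f g) :
    ShortComplex (ModuleCat.{0} R) :=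
  ShortComplex.moduleCatMk f g h.exact.linearMap_comp_eq_zero

lemma IsSES.shortExact {f : A →ₗ[R] B} {g : B →ₗ[R] C} (h : IsSES f g) :
    h.complex.ShortExact :=
  ModuleCat.shortComplex_shortExact _ h.exact h.inj h.surj

/-- Contravariant functoriality of `Ext`. -/
noncomputable def extPre (L : Type) [AddCommGroup L] [Module R L] (i : ℕ) (f : A →ₗ[R] B) :
    ExtM R B L i →ₗ[R] ExtM R A L i :=
  (Abelian.Ext.mk₀ (ModuleCat.ofHom f)).precompOfLinear R _ (zero_add i)

/-- Covariant functoriality of `Ext`. -/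
noncomputable def extPost (A : Type) [AddCommGroup A] [Module R A] (i : ℕ) (f : L →ₗ[R] L') :
    ExtM R A L i →ₗ[R] ExtM R A L' i :=
  (Abelian.Ext.mk₀ (ModuleCat.ofHom f)).postcompOfLinear R _ (add_zero i)

lemma extPre_apply (i : ℕ) (f : A →ₗ[R] B) (x : ExtM R B L i) :
    extPre L i f x = (Abelian.Ext.mk₀ (ModuleCat.ofHom f)).comp x (zero_add i) := rfl

lemma extPost_apply (i : ℕ) (f : L →ₗ[R] L') (x : ExtM R A L i) :
    extPost A i f x = x.comp (Abelian.Ext.mk₀ (ModuleCat.ofHom f)) (add_zero i) := rfl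

lemma extPre_id (i : ℕ) (x : ExtM R A L i) : extPre L i LinearMap.id x = x := by
  rw [extPre_apply]
  exact Abelian.Ext.mk₀_id_comp x

lemma extPost_id (i : ℕ) (x : ExtM R A L i) : extPost A i LinearMap.id x = x := by
  rw [extPost_apply]
  exact Abelian.Ext.comp_mk₀_id x

lemma extPre_comp (i : ℕ) (f : A →ₗ[R] B) (g : B →ₗ[R] C) (x : ExtM R C L i) :
    extPre L i (g ∘ₗ f) x = extPre L i f (extPre L i g x) := by
  simp only [extPre_apply, ModuleCat.ofHom_comp]
  rw [Abelian.Ext.mk₀_comp_mk₀_assoc]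

lemma extPost_comp (i : ℕ) (f : L →ₗ[R] L') (g : L' →ₗ[R] L'') (x : ExtM R A L i) :
    extPost A i (g ∘ₗ f) x = extPost A i g (extPost A i f x) := by
  simp only [extPost_apply, ModuleCat.ofHom_comp]
  rw [Abelian.Ext.comp_assoc_of_third_deg_zero, Abelian.Ext.mk₀_comp_mk₀]

lemma extPre_smul_id (i : ℕ) (r : R) (x : ExtM R A L i) :
    extPre L i (r • LinearMap.id) x = r • x := by
  rw [extPre_apply, show ModuleCat.ofHom (r • (LinearMap.id : A →ₗ[R] A)) =
    r • 𝟙 (ModuleCat.of R A) from rfl, Abelian.Ext.mk₀_smul, Abelian.Ext.smul_comp]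
  congr 1
  exact Abelian.Ext.mk₀_id_comp x

lemma extPost_add (i : ℕ) (f g : L →ₗ[R] L') (x : ExtM R A L i) :
    extPost A i (f + g) x = extPost A i f x + extPost A i g x := by
  simp only [extPost_apply, ModuleCat.ofHom_add, Abelian.Ext.mk₀_add, Abelian.Ext.comp_add]

lemma extPost_zero (i : ℕ) (x : ExtM R A L i) :
    extPost A i (0 : L →ₗ[R] L') x = 0 := by
  rw [extPost_apply, ModuleCat.ofHom_zero, Abelian.Ext.mk₀_zero, Abelian.Ext.comp_zero]

lemma extPre_zero (i : ℕ) (x : ExtM R B L i) :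
    extPre L i (0 : A →ₗ[R] B) x = 0 := by
  rw [extPre_apply, ModuleCat.ofHom_zero, Abelian.Ext.mk₀_zero, Abelian.Ext.zero_comp]

/-- `Ext` of isomorphic modules in the first variable. -/
noncomputable def extCongrLeft (i : ℕ) (e : A ≃ₗ[R] B) : ExtM R B L i ≃ₗ[R] ExtM R A L i :=
  LinearEquiv.ofLinearMap (extPre L i e.toLinearMap) (extPre L i e.symm.toLinearMap)
    (by ext x : 1; simp only [LinearMap.comp_apply, ← extPre_comp]; simp [extPre_id])
    (by ext x : 1; simp only [LinearMap.comp_apply, ← extPre_comp]; simp [extPre_id])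

/-- `Ext` of isomorphic modules in the second variable. -/
noncomputable def extCongrRight (i : ℕ) (e : L ≃ₗ[R] L') : ExtM R A L i ≃ₗ[R] ExtM R A L' i :=
  LinearEquiv.ofLinearMap (extPost A i e.toLinearMap) (extPost A i e.symm.toLinearMap)
    (by ext x : 1; simp only [LinearMap.comp_apply, ← extPost_comp]; simp [extPost_id])
    (by ext x : 1; simp only [LinearMap.comp_apply, ← extPost_comp]; simp [extPost_id])

/-- `Ext^0` is `Hom`. -/
noncomputable def extZeroEquiv : ExtM R A L 0 ≃ₗ[R] (A →ₗ[R] L) :=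
  Abelian.Ext.linearEquiv₀ ≪≫ₗ ModuleCat.homLinearEquiv

lemma extZeroEquiv_symm_apply (φ : A →ₗ[R] L) :
    (extZeroEquiv.symm φ : ExtM R A L 0) = Abelian.Ext.mk₀ (ModuleCat.ofHom φ) := by
  simp [extZeroEquiv]
  rfl

lemma extZeroEquiv_extPre (f : A →ₗ[R] B) (x : ExtM R B L 0) :
    extZeroEquiv (extPre L 0 f x) = extZeroEquiv x ∘ₗ f := by
  obtain ⟨φ, rfl⟩ := extZeroEquiv.symm.surjective x
  rw [LinearEquiv.apply_symm_apply, ← LinearEquiv.eq_symm_apply, extZeroEquiv_symm_apply,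
    extZeroEquiv_symm_apply, extPre_apply, Abelian.Ext.mk₀_comp_mk₀]
  rfl

lemma ext_subsingleton_of_projective [Module.Projective R A] (i : ℕ) :
    Subsingleton (ExtM R A L (i + 1)) := by
  have : Projective (ModuleCat.of R A) := (IsProjective.iff_projective _).1 inferInstance
  exact ⟨fun x y => by
    rw [Abelian.Ext.eq_zero_of_projective x, Abelian.Ext.eq_zero_of_projective y]⟩

section LES

variable {f : A →ₗ[R] B} {g : B →ₗ[R] C} (h : IsSES f g)

/-- The connecting map of the contravariant long exact sequence. -/
noncomputable def IsSES.δ (L : Type) [AddCommGroup L] [Module R L] (i : ℕ) :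
    ExtM R A L i →ₗ[R] ExtM R C L (i + 1) :=
  h.shortExact.extClass.precompOfLinear R _ (add_comm 1 i)

lemma IsSES.exact_pre_pre (h : IsSES f g) (i : ℕ) : Function.Exact (extPre L i g) (extPre L i f) := by
  intro x
  constructor
  · intro hx
    exact Abelian.Ext.contravariant_sequence_exact₂ h.shortExact _ x hx
  · rintro ⟨y, rfl⟩
    rw [← extPre_comp, h.exact.linearMap_comp_eq_zero, extPre_zero]

lemma IsSES.exact_pre_δ (i : ℕ) : Function.Exact (extPre L i f) (h.δ L i) := by
  intro x
  constructor
  · intro hx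
    exact Abelian.Ext.contravariant_sequence_exact₁ h.shortExact _ x (add_comm 1 i) hx
  · rintro ⟨y, rfl⟩
    exact h.shortExact.extClass_comp_assoc y (h := add_comm 1 i)

lemma IsSES.exact_δ_pre (i : ℕ) : Function.Exact (h.δ L i) (extPre L (i + 1) g) := by
  intro x
  constructor
  · intro hx
    exact Abelian.Ext.contravariant_sequence_exact₃ h.shortExact _ x hx (add_comm 1 i)
  · rintro ⟨y, rfl⟩
    exact h.shortExact.comp_extClass_assoc y (add_comm 1 i)

lemma IsSES.pre_zero_injective (h : IsSES f g) : Function.Injective (extPre L 0 g) := by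
  have : Epi (ModuleCat.ofHom g) := (ModuleCat.epi_iff_surjective _).2 h.surj
  exact Abelian.Ext.precomp_mk₀_injective_of_epi (ModuleCat.of R L) (ModuleCat.ofHom g)

lemma comp_extClass_eq_zero {S : ShortComplex (ModuleCat.{0} R)} (hS : S.ShortExact)
    {X : ModuleCat.{0} R} {i : ℕ} (y : Abelian.Ext X S.X₂ i) :
    (y.comp (Abelian.Ext.mk₀ S.g) (add_zero i)).comp hS.extClass (rfl : i + 1 = i + 1) = 0 := by
  rw [Abelian.Ext.comp_assoc_of_second_deg_zero, hS.comp_extClass, Abelian.Ext.comp_zero]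

/-- The connecting map of the covariant long exact sequence. -/
noncomputable def IsSES.δ' (L : Type) [AddCommGroup L] [Module R L] (i : ℕ) :
    ExtM R L C i →ₗ[R] ExtM R L A (i + 1) :=
  h.shortExact.extClass.postcompOfLinear R _ rfl

lemma IsSES.exact_post_δ (i : ℕ) : Function.Exact (extPost L i g) (h.δ' L i) := by
  intro x
  constructor
  · intro hx
    exact Abelian.Ext.covariant_sequence_exact₃ _ h.shortExact x rfl hx
  · rintro ⟨y, rfl⟩
    exact comp_extClass_eq_zero h.shortExact y

end LES

/-- The tautological short exact sequence of a surjection. -/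
lemma isSES_ker {g : B →ₗ[R] C} (hg : Function.Surjective g) :
    IsSES (LinearMap.ker g).subtype g :=
  ⟨Subtype.val_injective, hg, LinearMap.exact_subtype_ker_map g⟩

lemma isSES_mkQ (P : Submodule R B) : IsSES P.subtype P.mkQ :=
  ⟨Subtype.val_injective, P.mkQ_surjective, LinearMap.exact_subtype_mkQ P⟩

lemma subsingleton_of_exact {X Y Z : Type*} [AddCommGroup X] [AddCommGroup Y] [AddCommGroup Z]
    [Module R X] [Module R Y] [Module R Z] {f : X →ₗ[R] Y} {g : Y →ₗ[R] Z}
    (h : Function.Exact f g) [Subsingleton X] [Subsingleton Z] : Subsingleton Y := by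
  refine ⟨fun a b => ?_⟩
  have : ∀ a : Y, a = 0 := fun a => by
    obtain ⟨x, rfl⟩ := (h a).1 (Subsingleton.elim _ _)
    rw [Subsingleton.elim x 0, map_zero]
  rw [this a, this b]

end ModuleExt

section PdLT

variable (R : Type) [CommRing R]

/-- The projective dimension of `N` is less than `d`. -/
abbrev PdLT (N : Type) [AddCommGroup N] [Module R N] (d : ℕ) : Prop :=
  HasProjectiveDimensionLT (ModuleCat.of R N) d

variable {R}
variable {A B C : Type} [AddCommGroup A] [Module R A] [AddCommGroup B] [Module R B]
  [AddCommGroup C] [Module R C]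

lemma PdLT.mono {d e : ℕ} (h : PdLT R A d) (hde : d ≤ e) : PdLT R A e :=
  hasProjectiveDimensionLT_of_ge _ _ _ hde

lemma PdLT.congr {d : ℕ} (h : PdLT R A d) (e : A ≃ₗ[R] B) : PdLT R B d :=
  hasProjectiveDimensionLT_of_iso (X := ModuleCat.of R A) e.toModuleIso d

lemma pdLT_one_of_projective [Module.Projective R A] : PdLT R A 1 := by
  have : Projective (ModuleCat.of R A) := (IsProjective.iff_projective _).1 inferInstance
  infer_instance

lemma projective_of_pdLT_one (h : PdLT R A 1) : Module.Projective R A :=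
  (IsProjective.iff_projective _).2 (projective_iff_hasProjectiveDimensionLT_one.2 h)

lemma pdLT_zero_of_subsingleton [Subsingleton A] : PdLT R A 0 :=
  (hasProjectiveDimensionLT_zero_iff_isZero _).2 (ModuleCat.isZero_of_subsingleton _)

lemma PdLT.ext_subsingleton {d i : ℕ} (h : PdLT R A d) (hi : d ≤ i) (L : Type) [AddCommGroup L]
    [Module R L] : Subsingleton (ExtM R A L i) :=
  HasProjectiveDimensionLT.subsingleton _ d i hi _

variable {f : A →ₗ[R] B} {g : B →ₗ[R] C}

lemma IsSES.pdLT_right (h : IsSES f g) {d : ℕ} (h₁ : PdLT R A d) (h₂ : PdLT R B (d + 1)) :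
    PdLT R C (d + 1) :=
  h.shortExact.hasProjectiveDimensionLT_X₃ d h₁ h₂

lemma IsSES.pdLT_left (h : IsSES f g) {d : ℕ} (h₁ : PdLT R B d) (h₂ : PdLT R C (d + 1)) :
    PdLT R A d :=
  h.shortExact.hasProjectiveDimensionLT_X₁ d h₁ h₂

end PdLT

section Syzygy

open Polynomial TensorProduct

variable {A : Type} [CommRing A]

lemma IsSES.baseChange {M N P : Type} [AddCommGroup M] [Module A M] [AddCommGroup N] [Module A N]
    [AddCommGroup P] [Module A P] {f : M →ₗ[A] N} {g : N →ₗ[A] P} (h : IsSES f g)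
    (B : Type) [CommRing B] [Algebra A B] [Module.Flat A B] :
    IsSES (f.baseChange B) (g.baseChange B) :=
  ⟨Module.Flat.lTensor_preserves_injective_linearMap _ h.inj,
    LinearMap.lTensor_surjective _ h.surj, lTensor_exact _ h.exact h.surj⟩

lemma pdLT_baseChange (d : ℕ) (N : Type) [AddCommGroup N] [Module A N] (h : PdLT A N (d + 1)) :
    PdLT A[X] (A[X] ⊗[A] N) (d + 1) := by
  induction d generalizing N with
  | zero =>
    have := projective_of_pdLT_one h
    exact pdLT_one_of_projective
  | succ d ih =>
    let p : (N →₀ A) →ₗ[A] N := Finsupp.linearCombination A id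
    have hp : Function.Surjective p := Finsupp.linearCombination_id_surjective A N
    have hΩ : PdLT A (LinearMap.ker p) (d + 1) :=
      (isSES_ker hp).pdLT_left (pdLT_one_of_projective.mono (by lia)) h
    exact ((isSES_ker hp).baseChange A[X]).pdLT_right (ih _ hΩ) (pdLT_one_of_projective.mono (by lia))

lemma pdLT_polynomialModule (d : ℕ) (N : Type) [AddCommGroup N] [Module A N]
    (h : PdLT A N (d + 1)) : PdLT A[X] (PolynomialModule A N) (d + 1) :=
  (pdLT_baseChange d N h).congr
    (PolynomialModule.polynomialTensorProductLEquivPolynomialModule A N)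

variable (N : Type) [AddCommGroup N] [Module A N] [Module A[X] N] [IsScalarTower A A[X] N]

/-- Multiplication by the variable as an endomorphism over the base ring. -/
noncomputable def mulX : N →ₗ[A] N := (LinearMap.lsmul A[X] N X).restrictScalars A

/-- The endomorphism of `N[X]` whose cokernel is the `A[X]`-module `N`. -/
noncomputable def charMap : PolynomialModule A N →ₗ[A[X]] PolynomialModule A N where
  toFun p := (X : A[X]) • p - PolynomialModule.map A (mulX N) p
  map_add' p q := by simp only [smul_add, map_add]; abel
  map_smul' r p := by
    rw [PolynomialModule.map_smul, smul_sub, smul_comm]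
    simp

/-- The evaluation map `N[X] → N`. -/
noncomputable def evalMap : PolynomialModule A N →ₗ[A[X]] N where
  toFun p := p.coeff.sum fun i m => (X : A[X]) ^ i • m
  map_add' p q := by
    rw [PolynomialModule.coeff_add, Finsupp.sum_add_index'] <;> simp
  map_smul' r p := by
    have hadd : ∀ p q : PolynomialModule A N, ((p + q).coeff.sum fun i m => (X : A[X]) ^ i • m) =
        (p.coeff.sum fun i m => (X : A[X]) ^ i • m) + q.coeff.sum fun i m => (X : A[X]) ^ i • m :=
      fun p q => by rw [PolynomialModule.coeff_add, Finsupp.sum_add_index'] <;> simp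
    induction p using PolynomialModule.induction_linear with
    | zero => simp
    | add p q hp hq => rw [smul_add, hadd, hadd, hp, hq, smul_add]
    | single j m =>
      induction r using Polynomial.induction_on' with
      | add p q hp hq => rw [add_smul, hadd, hp, hq]; simp only [RingHom.id_apply, add_smul]
      | monomial i a =>
        rw [PolynomialModule.monomial_smul_single]
        simp only [PolynomialModule.coeff_single, RingHom.id_apply]
        rw [Finsupp.sum_single_index (by simp), Finsupp.sum_single_index (by simp),
          ← Polynomial.C_mul_X_pow_eq_monomial, mul_smul, ← mul_smul (Polynomial.X ^ i), ← pow_add,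
          smul_comm]
        exact (algebraMap_smul A[X] a _).symm

lemma evalMap_single (i : ℕ) (m : N) :
    evalMap N (PolynomialModule.single A i m) = (X : A[X]) ^ i • m := by
  simp [evalMap, Finsupp.sum_single_index]

lemma charMap_single (i : ℕ) (m : N) :
    charMap N (PolynomialModule.single A i m) =
      PolynomialModule.single A (i + 1) m - PolynomialModule.single A i ((X : A[X]) • m) := by
  simp only [charMap, LinearMap.coe_mk, AddHom.coe_mk, PolynomialModule.map_single]
  rw [← Polynomial.monomial_one_one_eq_X, PolynomialModule.monomial_smul_single, one_smul, add_comm]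
  rfl

lemma exists_charMap_add (p : PolynomialModule A N) :
    ∃ q c, p = charMap N q + PolynomialModule.single A 0 c := by
  induction p using PolynomialModule.induction_linear with
  | zero => exact ⟨0, 0, by simp⟩
  | add p q hp hq =>
    obtain ⟨p', c, hp⟩ := hp
    obtain ⟨q', d, hq⟩ := hq
    exact ⟨p' + q', c + d, by rw [hp, hq, map_add, PolynomialModule.single_add]; abel⟩
  | single i m =>
    induction i generalizing m with
    | zero => exact ⟨0, m, by simp⟩
    | succ i ih =>
      obtain ⟨q, c, hq⟩ := ih ((X : A[X]) • m)
      refine ⟨q + PolynomialModule.single A i m, c, ?_⟩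
      rw [map_add, charMap_single, hq]
      abel

lemma coeff_charMap_succ (p : PolynomialModule A N) (i : ℕ) :
    (charMap N p).coeff (i + 1) = p.coeff i - (X : A[X]) • p.coeff (i + 1) := by
  induction p using PolynomialModule.induction_linear with
  | zero => simp
  | add p q hp hq =>
    simp only [map_add, PolynomialModule.coeff_add, Finsupp.add_apply, hp, hq, smul_add]
    abel
  | single j m =>
    have hsub : ∀ a b : PolynomialModule A N, (a - b).coeff = a.coeff - b.coeff :=
      fun a b => map_sub (PolynomialModule.coeffLinearEquiv A A) a b
    rw [charMap_single]
    simp only [hsub, PolynomialModule.coeff_single, Finsupp.sub_apply,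
      Finsupp.single_apply]
    split_ifs <;> simp_all

lemma isSES_charMap : IsSES (charMap (A := A) N) (evalMap N) := by
  refine ⟨?_, fun m => ⟨PolynomialModule.single A 0 m, by simp [evalMap_single]⟩, ?_⟩
  · rw [← LinearMap.ker_eq_bot, LinearMap.ker_eq_bot']
    intro p hp
    have hstep : ∀ i, p.coeff i = (X : A[X]) • p.coeff (i + 1) := fun i => by
      rw [← sub_eq_zero, ← coeff_charMap_succ, hp]; simp
    have hlarge : ∃ k, ∀ i, k ≤ i → p.coeff i = 0 := by
      refine ⟨p.coeff.support.sup id + 1, fun i hi => ?_⟩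
      by_contra h
      have := Finset.le_sup (f := id) (Finsupp.mem_support_iff.2 h)
      simp only [id] at this hi
      omega
    obtain ⟨k, hk⟩ := hlarge
    have : ∀ j i, k ≤ i + j → p.coeff i = 0 := by
      intro j
      induction j with
      | zero => exact fun i hi => hk i hi
      | succ j ih => intro i hi; rw [hstep, ih (i + 1) (by lia), smul_zero]
    apply PolynomialModule.coeff_injective
    ext i
    exact this k i (by lia)
  · have hzero : ∀ q : PolynomialModule A N, evalMap N (charMap N q) = 0 := by
      intro q
      induction q using PolynomialModule.induction_linear with
      | zero => simp
      | add p q hp hq => rw [map_add, map_add, hp, hq, add_zero]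
      | single i m =>
        rw [charMap_single, map_sub, evalMap_single, evalMap_single, pow_succ, mul_smul, sub_self]
    intro p
    constructor
    · intro hp
      obtain ⟨q, c, rfl⟩ := exists_charMap_add (A := A) N p
      rw [map_add, hzero, zero_add, evalMap_single, pow_zero, one_smul] at hp
      exact ⟨q, by simp [hp]⟩
    · rintro ⟨q, rfl⟩
      exact hzero q

variable (A) in
lemma pdLT_polynomial (d : ℕ)
    (h : ∀ (N : Type) [AddCommGroup N] [Module A N], PdLT A N (d + 1))
    (N : Type) [AddCommGroup N] [Module A[X] N] : PdLT A[X] N (d + 2) := by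
  let : Module A N := Module.compHom N (Polynomial.C : A →+* A[X])
  have : IsScalarTower A A[X] N := ⟨fun a p n => by
    rw [Polynomial.smul_eq_C_mul, mul_smul]; rfl⟩
  exact (isSES_charMap N).pdLT_right (pdLT_polynomialModule d N (h N))
    ((pdLT_polynomialModule d N (h N)).mono (by lia))

lemma pdLT_of_ringEquiv {R S : Type} [CommRing R] [CommRing S] (e : R ≃+* S) (d : ℕ)
    (h : ∀ (N : Type) [AddCommGroup N] [Module R N], PdLT R N (d + 1))
    (N : Type) [AddCommGroup N] [Module S N] : PdLT S N (d + 1) := by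
  let : Module R N := Module.compHom N (e : R →+* S)
  have := h N
  let := RingHomInvPair.of_ringEquiv e
  let := RingHomInvPair.of_ringEquiv e.symm
  let e' : N ≃ₛₗ[RingHomClass.toRingHom e] N :=
    { AddEquiv.refl N with map_smul' := fun r m => rfl }
  exact ModuleCat.hasProjectiveDimensionLE_of_semiLinearEquiv (M := ModuleCat.of R N)
    (N := ModuleCat.of S N) e e' d

/-- **Hilbert's syzygy theorem**. -/
theorem pdLT_mvPolynomial (K : Type) [Field K] (n : ℕ) (N : Type) [AddCommGroup N]
    [Module (MvPolynomial (Fin n) K) N] : PdLT (MvPolynomial (Fin n) K) N (n + 1) := by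
  induction n generalizing N with
  | zero =>
    exact pdLT_of_ringEquiv (MvPolynomial.isEmptyRingEquiv K (Fin 0)).symm 0
      (fun N _ _ => pdLT_one_of_projective) N
  | succ n ih =>
    exact pdLT_of_ringEquiv (MvPolynomial.finSuccEquiv K n).symm.toRingEquiv (n + 1)
      (fun N _ _ => pdLT_polynomial _ n ih N) N

end Syzygy

section Dual

variable {R : Type} [CommRing R]
variable {A B L L' : Type} [AddCommGroup A] [Module R A] [AddCommGroup B] [Module R B]
  [AddCommGroup L] [Module R L] [AddCommGroup L'] [Module R L']

/-- The dual of a finitely generated module over a ring of global dimension at most `m + 1` has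
projective dimension at most `m - 1`. -/
lemma pdLT_dual [IsNoetherianRing R] {m : ℕ} (hm : 1 ≤ m)
    (hgl : ∀ (N : Type) [AddCommGroup N] [Module R N], PdLT R N (m + 2)) [Module.Finite R L] :
    PdLT R (L →ₗ[R] R) m := by
  obtain ⟨k, p, hp⟩ := Module.Finite.exists_fin' R L
  obtain ⟨l, q, hq⟩ := Module.Finite.exists_fin' R (LinearMap.ker p)
  let φ := LinearMap.lcomp R R ((LinearMap.ker p).subtype ∘ₗ q)
  have hφ : PdLT R (LinearMap.ker φ) m := by
    refine (isSES_ker φ.surjective_rangeRestrict).pdLT_left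
      (pdLT_one_of_projective.mono hm) ((isSES_mkQ (LinearMap.range φ)).pdLT_left
      (pdLT_one_of_projective.mono (by lia)) (hgl _)) |>.congr ?_
    exact LinearEquiv.ofEq _ _ (LinearMap.ker_rangeRestrict φ)
  have hmem : ∀ f : L →ₗ[R] R, f ∘ₗ p ∈ LinearMap.ker φ := by
    intro f
    rw [LinearMap.mem_ker]
    ext x
    simp [φ]
  let ψ : (L →ₗ[R] R) →ₗ[R] LinearMap.ker φ := (LinearMap.lcomp R R p).codRestrict _ hmem
  refine hφ.congr (LinearEquiv.ofBijective ψ ⟨?_, ?_⟩).symm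
  · intro f g hfg
    have h1 : f ∘ₗ p = g ∘ₗ p := congrArg Subtype.val hfg
    exact (LinearMap.cancel_right hp).1 h1
  · rintro ⟨f, hf⟩
    have hle : LinearMap.ker p ≤ LinearMap.ker f := by
      intro x hx
      obtain ⟨y, hy⟩ := hq ⟨x, hx⟩
      have := LinearMap.congr_fun hf y
      simpa [φ, hy] using this
    refine ⟨(LinearMap.ker p).liftQ f hle ∘ₗ (p.quotKerEquivOfSurjective hp).symm, ?_⟩
    apply Subtype.ext
    refine LinearMap.ext fun x => ?_
    change (LinearMap.ker p).liftQ f hle ((p.quotKerEquivOfSurjective hp).symm (p x)) = f x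
    have : (p.quotKerEquivOfSurjective hp).symm (p x) = (LinearMap.ker p).mkQ x := by
      rw [LinearEquiv.symm_apply_eq]; rfl
    rw [this]
    rfl

lemma IsSES.ext_equiv_of_subsingleton {C : Type} [AddCommGroup C] [Module R C]
    {f : A →ₗ[R] B} {g : B →ₗ[R] C} (h : IsSES f g) (i : ℕ)
    (h0 : Subsingleton (ExtM R B L i)) (h1 : Subsingleton (ExtM R B L (i + 1))) :
    Nonempty (ExtM R A L i ≃ₗ[R] ExtM R C L (i + 1)) := by
  refine ⟨LinearEquiv.ofBijective (h.δ L i) ⟨?_, ?_⟩⟩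
  · rw [← LinearMap.ker_eq_bot, LinearMap.ker_eq_bot']
    intro x hx
    obtain ⟨y, rfl⟩ := (h.exact_pre_δ i x).1 hx
    rw [Subsingleton.elim y 0, map_zero]
  · intro x
    exact (h.exact_δ_pre i x).1 (Subsingleton.elim _ _)

lemma pdLT_ext [IsNoetherianRing R] {N : ℕ}
    (hdual : ∀ (W : Type) [AddCommGroup W] [Module R W] [Module.Finite R W],
      PdLT R (W →ₗ[R] R) N) (c : ℕ) (q : ℕ) (L : Type) [AddCommGroup L] [Module R L]
    [Module.Finite R L] (hq : PdLT R (ExtM R L R 0) q)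
    (hL : ∀ i, i < c → Subsingleton (ExtM R L R (i + 1))) :
    PdLT R (ExtM R L R (c + 1)) (max N (q + c + 2)) := by
  induction c generalizing q L with
  | zero =>
    obtain ⟨k, p, hp⟩ := Module.Finite.exists_fin' R L
    have hs := isSES_ker hp
    let φ := extPre R 0 (LinearMap.ker p).subtype
    have hses : IsSES (extPre R 0 p) φ.rangeRestrict := by
      refine ⟨hs.pre_zero_injective, φ.surjective_rangeRestrict, fun x => ?_⟩
      rw [← hs.exact_pre_pre 0 x]
      exact ⟨fun h => congrArg Subtype.val h, fun h => Subtype.ext h⟩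
    have hB : PdLT R (LinearMap.range φ) (q + 1) :=
      hses.pdLT_right hq ((pdLT_one_of_projective.congr extZeroEquiv.symm).mono (by lia))
    have hsub : Subsingleton (ExtM R (Fin k → R) R 1) := ext_subsingleton_of_projective 0
    have hses2 : IsSES (LinearMap.range φ).subtype (hs.δ R 0) := by
      refine ⟨Subtype.val_injective, ?_, ?_⟩
      · intro x
        exact (hs.exact_δ_pre 0 x).1 (Subsingleton.elim _ _)
      · intro x
        rw [hs.exact_pre_δ 0 x]
        simp [φ]
    rw [show max N (q + 0 + 2) = max (N - 1) (q + 1) + 1 by lia]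
    exact hses2.pdLT_right (hB.mono (by lia))
      (((hdual _).congr extZeroEquiv.symm).mono (by lia))
  | succ c ih =>
    obtain ⟨k, p, hp⟩ := Module.Finite.exists_fin' R L
    have hs := isSES_ker hp
    have h1 := hL 0 (by lia)
    have hses : IsSES (extPre R 0 p) (extPre R 0 (LinearMap.ker p).subtype) := by
      refine ⟨hs.pre_zero_injective, fun x => ?_, hs.exact_pre_pre 0⟩
      exact (hs.exact_pre_δ 0 x).1 (Subsingleton.elim _ _)
    have hΩ : PdLT R (ExtM R (LinearMap.ker p) R 0) (q + 1) :=
      hses.pdLT_right hq ((pdLT_one_of_projective.congr extZeroEquiv.symm).mono (by lia))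
    have hiso : ∀ i, Nonempty (ExtM R (LinearMap.ker p) R (i + 1) ≃ₗ[R] ExtM R L R (i + 2)) :=
      fun i => hs.ext_equiv_of_subsingleton (i + 1) (ext_subsingleton_of_projective i)
        (ext_subsingleton_of_projective (i + 1))
    have := ih (q + 1) (LinearMap.ker p) hΩ (fun i hi => by
      have := hL (i + 1) (by lia)
      exact (hiso i).some.toEquiv.subsingleton)
    rw [show q + (c + 1) + 2 = q + 1 + c + 2 by lia]
    exact this.congr (hiso c).some

lemma ext_pi_subsingleton (i k : ℕ) (h : Subsingleton (ExtM R A L i)) :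
    Subsingleton (ExtM R A (Fin k → L) i) := by
  have : ∀ x : ExtM R A (Fin k → L) i, x = 0 := by
    intro x
    have hsum : ∀ s : Finset (Fin k), extPost A i (∑ j ∈ s, LinearMap.single R (fun _ => L) j ∘ₗ
        LinearMap.proj j) x = 0 := by
      intro s
      induction s using Finset.induction_on with
      | empty => rw [Finset.sum_empty, extPost_zero]
      | insert j s hj ih =>
        rw [Finset.sum_insert hj, extPost_add, ih, add_zero, extPost_comp,
          Subsingleton.elim (extPost A i (LinearMap.proj j) x) 0, map_zero]
    rw [← hsum Finset.univ]
    conv_lhs => rw [← extPost_id i x]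
    congr 2
    ext j y l
    simp [Pi.single_apply, eq_comm]
  exact ⟨fun x y => by rw [this x, this y]⟩

lemma pdLT_of_ext_subsingleton [IsNoetherianRing R] (m : ℕ) [Module.Finite R A]
    (hpd : PdLT R A (m + 1)) (hext : Subsingleton (ExtM R A R m)) : PdLT R A m := by
  refine ModuleCat.hasProjectiveDimensionLT_of_forall_finite _ m fun L hL => ?_
  have : Module.Finite R L := hL
  obtain ⟨k, p, hp⟩ := Module.Finite.exists_fin' R L
  have h1 := ext_pi_subsingleton m k hext
  have h2 := hpd.ext_subsingleton le_rfl (LinearMap.ker p)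
  exact subsingleton_of_exact ((isSES_ker hp).exact_post_δ m)

lemma ext_subsingleton_of_pdLT [IsNoetherianRing R] (X : Type) [AddCommGroup X] [Module R X]
    (n : ℕ) (hX : ∀ i < n, Subsingleton (ExtM R X R i)) (m : ℕ) (N : Type) [AddCommGroup N]
    [Module R N] [Module.Finite R N] (hN : PdLT R N m) (i : ℕ) (hi : i + m ≤ n) :
    Subsingleton (ExtM R X N i) := by
  induction m generalizing N i with
  | zero =>
    have h0 : ∀ x : N, x = 0 := by
      have := (hasProjectiveDimensionLT_zero_iff_isZero _).1 hN
      have := ModuleCat.subsingleton_of_isZero this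
      exact fun x => Subsingleton.elim (α := ModuleCat.of R N) _ _
    have hid : (LinearMap.id : N →ₗ[R] N) = 0 := LinearMap.ext fun x => by rw [h0 x]; simp
    have : ∀ x : ExtM R X N i, x = 0 := fun x => by rw [← extPost_id i x, hid, extPost_zero]
    exact ⟨fun x y => by rw [this x, this y]⟩
  | succ m ih =>
    obtain ⟨k, p, hp⟩ := Module.Finite.exists_fin' R N
    have hF := ext_pi_subsingleton i k (hX i (by lia))
    rcases Nat.eq_zero_or_pos m with rfl | hm
    · have := projective_of_pdLT_one hN
      obtain ⟨s, hs⟩ := Module.projective_lifting_property p LinearMap.id hp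
      have : ∀ x : ExtM R X N i, x = 0 := fun x => by
        rw [← extPost_id i x, ← hs, extPost_comp, Subsingleton.elim (extPost X i s x) 0, map_zero]
      exact ⟨fun x y => by rw [this x, this y]⟩
    · have hΩ := (isSES_ker hp).pdLT_left (pdLT_one_of_projective.mono hm) hN
      have := ih (LinearMap.ker p) hΩ (i + 1) (by lia)
      exact subsingleton_of_exact ((isSES_ker hp).exact_post_δ i)

end Dual

section Concentrated

variable {R : Type} [CommRing R]
variable {A B C : Type} [AddCommGroup A] [Module R A] [AddCommGroup B] [Module R B]
  [AddCommGroup C] [Module R C]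

variable (R) in
/-- `Ext^i(N, R)` vanishes for `i ≠ k` and is isomorphic to `N` for `i = k`. -/
structure SelfDualExt (N : Type) [AddCommGroup N] [Module R N] (k : ℕ) : Prop where
  vanish : ∀ i, i ≠ k → Subsingleton (ExtM R N R i)
  iso : Nonempty (ExtM R N R k ≃ₗ[R] N)

lemma selfDualExt_self : SelfDualExt R R 0 where
  vanish i hi := by
    obtain ⟨j, rfl⟩ := Nat.exists_eq_succ_of_ne_zero hi
    exact ext_subsingleton_of_projective j
  iso := ⟨extZeroEquiv.trans (LinearMap.ringLmapEquivSelf R R R)⟩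

lemma SelfDualExt.congr {k : ℕ} (h : SelfDualExt R A k) (e : A ≃ₗ[R] B) : SelfDualExt R B k where
  vanish i hi := by
    have := h.vanish i hi
    exact (extCongrLeft i e).toEquiv.subsingleton
  iso := ⟨(extCongrLeft k e).trans (h.iso.some.trans e)⟩

lemma SelfDualExt.smul_injective {k : ℕ} (h : SelfDualExt R A k) {r : R}
    (hr : Function.Injective (r • (LinearMap.id : A →ₗ[R] A))) (i : ℕ) :
    Function.Injective (extPre R i (r • (LinearMap.id : A →ₗ[R] A))) := by
  by_cases hi : i = k
  · subst hi
    obtain ⟨e⟩ := h.iso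
    intro x y hxy
    rw [extPre_smul_id, extPre_smul_id] at hxy
    apply e.injective
    apply hr
    simpa using congrArg e hxy
  · have := h.vanish i hi
    exact Function.injective_of_subsingleton _

/-- Surjections with the same kernel have isomorphic targets. -/
lemma nonempty_equiv_of_ker_eq {f : A →ₗ[R] B} {g : A →ₗ[R] C} (hf : Function.Surjective f)
    (hg : Function.Surjective g) (h : LinearMap.ker f = LinearMap.ker g) :
    Nonempty (B ≃ₗ[R] C) :=
  ⟨(f.quotKerEquivOfSurjective hf).symm.trans
    ((Submodule.quotEquivOfEq _ _ h).trans (g.quotKerEquivOfSurjective hg))⟩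

lemma SelfDualExt.succ {k : ℕ} (h : SelfDualExt R A k) {r : R} {g : A →ₗ[R] B}
    (hs : IsSES (r • (LinearMap.id : A →ₗ[R] A)) g) : SelfDualExt R B (k + 1) := by
  have hz : ∀ i (x : ExtM R B R i), extPre R i g x = 0 := by
    intro i x
    apply h.smul_injective hs.inj i
    rw [map_zero, ← extPre_comp, hs.exact.linearMap_comp_eq_zero, extPre_zero]
  have hδ : ∀ i, Function.Surjective (hs.δ R i) := fun i x ↦
    (hs.exact_δ_pre i x).1 (hz _ x)
  refine ⟨fun i hi ↦ ?_, ?_⟩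
  · cases i with
    | zero =>
      refine ⟨fun x y ↦ hs.pre_zero_injective (L := R) ?_⟩
      rw [hz, hz]
    | succ i =>
      have := h.vanish i (by lia)
      exact (hδ i).subsingleton
  · obtain ⟨e⟩ := h.iso
    refine nonempty_equiv_of_ker_eq (f := hs.δ R k ∘ₗ e.symm.toLinearMap) (g := g)
      ((hδ k).comp e.symm.surjective) hs.surj ?_
    ext x
    rw [LinearMap.mem_ker, LinearMap.mem_ker, hs.exact x, LinearMap.comp_apply,
      LinearEquiv.coe_coe, hs.exact_pre_δ (L := R) k (e.symm x)]
    constructor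
    · rintro ⟨y, hy⟩
      rw [extPre_smul_id] at hy
      exact ⟨e y, by simpa using congrArg e hy⟩
    · rintro ⟨y, rfl⟩
      exact ⟨e.symm y, by simp [extPre_smul_id]⟩

end Concentrated

section VarIdeal

variable (K : Type) [Field K] {n : ℕ}

/-- The prime ideal generated by the variables with index in `T`. -/
noncomputable def varIdeal (T : Finset (Fin n)) : Ideal (MvPolynomial (Fin n) K) :=
  Ideal.span (X '' (T : Set (Fin n)))

/-- The projection setting the variables with index in `T` to zero. -/
noncomputable def killVars (T : Finset (Fin n)) :
    MvPolynomial (Fin n) K →ₐ[K] MvPolynomial {i // i ∉ T} K :=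
  aeval fun i ↦ if h : i ∈ T then 0 else X ⟨i, h⟩

lemma killVars_rename (T : Finset (Fin n)) (p : MvPolynomial {i // i ∉ T} K) :
    killVars K T (rename Subtype.val p) = p := by
  have : (killVars K T).comp (rename Subtype.val) = AlgHom.id K _ := by
    ext ⟨i, hi⟩ : 1
    simp [killVars, hi]
  exact DFunLike.congr_fun this p

lemma killVars_surjective (T : Finset (Fin n)) : Function.Surjective (killVars K T) :=
  fun p ↦ ⟨_, killVars_rename K T p⟩

lemma X_mem_varIdeal {T : Finset (Fin n)} {i : Fin n} (hi : i ∈ T) : X i ∈ varIdeal K T :=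
  Ideal.subset_span ⟨i, hi, rfl⟩

lemma sub_killVars_mem (T : Finset (Fin n)) (p : MvPolynomial (Fin n) K) :
    p - rename Subtype.val (killVars K T p) ∈ varIdeal K T := by
  rw [← Ideal.Quotient.eq]
  have : (Ideal.Quotient.mkₐ K (varIdeal K T)) =
      (Ideal.Quotient.mkₐ K (varIdeal K T)).comp ((rename Subtype.val).comp (killVars K T)) := by
    ext i : 1
    by_cases hi : i ∈ T
    · simpa [killVars, hi] using Ideal.Quotient.eq_zero_iff_mem.2 (X_mem_varIdeal K hi)
    · simp [killVars, hi]
  exact DFunLike.congr_fun this p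

lemma ker_killVars (T : Finset (Fin n)) : RingHom.ker (killVars K T) = varIdeal K T := by
  refine le_antisymm (fun p hp ↦ ?_) ?_
  · have := sub_killVars_mem K T p
    rwa [RingHom.mem_ker.1 hp, map_zero, sub_zero] at this
  · rw [varIdeal, Ideal.span_le]
    rintro _ ⟨i, hi, rfl⟩
    have hi : i ∈ T := hi
    simp [killVars, hi]

lemma mem_varIdeal {T : Finset (Fin n)} {p : MvPolynomial (Fin n) K} :
    p ∈ varIdeal K T ↔ killVars K T p = 0 := by
  rw [← ker_killVars, RingHom.mem_ker]

lemma X_mem_varIdeal_iff {T : Finset (Fin n)} {i : Fin n} : X i ∈ varIdeal K T ↔ i ∈ T := by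
  rw [mem_varIdeal]
  by_cases hi : i ∈ T <;> simp [killVars, hi]

instance varIdeal_isPrime (T : Finset (Fin n)) : (varIdeal K T).IsPrime := by
  rw [← ker_killVars]
  exact RingHom.ker_isPrime _

lemma ringKrullDim_quotient_varIdeal (T : Finset (Fin n)) :
    ringKrullDim (MvPolynomial (Fin n) K ⧸ varIdeal K T) = (n - T.card : ℕ) := by
  have e : (MvPolynomial (Fin n) K ⧸ RingHom.ker (killVars K T)) ≃+* MvPolynomial {i // i ∉ T} K :=
    RingHom.quotientKerEquivOfSurjective (killVars_surjective K T)
  rw [← ker_killVars, ringKrullDim_eq_of_ringEquiv e, MvPolynomial.ringKrullDim_of_isNoetherianRing,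
    ringKrullDim_eq_zero_of_field, zero_add]
  simp

lemma maxIdeal_eq_varIdeal : maxIdeal K n = varIdeal K Finset.univ := by
  simp [maxIdeal, varIdeal]

lemma selfDualExt_varIdeal (T : Finset (Fin n)) :
    SelfDualExt (MvPolynomial (Fin n) K) (MvPolynomial (Fin n) K ⧸ varIdeal K T) T.card := by
  classical
  induction T using Finset.induction_on with
  | empty =>
    rw [Finset.card_empty]
    refine selfDualExt_self.congr (Submodule.quotEquivOfEqBot _ ?_).symm
    simp [varIdeal]
  | insert j T hj ih =>
    rw [Finset.card_insert_of_notMem hj]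
    have hle : varIdeal K T ≤ varIdeal K (insert j T) :=
      Ideal.span_mono (Set.image_mono (by simp))
    have hins : varIdeal K (insert j T) = Ideal.span {X j} ⊔ varIdeal K T := by
      rw [varIdeal, varIdeal, Finset.coe_insert, Set.image_insert_eq, Ideal.span_insert]
    refine ih.succ (r := X j) (g := Submodule.factor hle) ⟨?_, Submodule.factor_surjective hle, ?_⟩
    · rw [injective_iff_map_eq_zero]
      intro p hp
      obtain ⟨p, rfl⟩ := Submodule.Quotient.mk_surjective _ p
      have h : X j * p ∈ varIdeal K T := (Submodule.Quotient.mk_eq_zero _).1 hp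
      refine (Submodule.Quotient.mk_eq_zero _).2 (((varIdeal_isPrime K T).mem_or_mem h).resolve_left ?_)
      rwa [X_mem_varIdeal_iff]
    · intro p
      obtain ⟨p, rfl⟩ := Submodule.Quotient.mk_surjective _ p
      constructor
      · intro h
        have h : p ∈ varIdeal K (insert j T) := (Submodule.Quotient.mk_eq_zero _).1 h
        rw [hins, Submodule.mem_sup] at h
        obtain ⟨y, hy, z, hz, rfl⟩ := h
        obtain ⟨a, rfl⟩ := Ideal.mem_span_singleton'.1 hy
        refine ⟨Submodule.Quotient.mk a, ?_⟩
        refine (Submodule.Quotient.eq _).2 ?_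
        have : (X j : MvPolynomial (Fin n) K) • a - (a * X j + z) = -z := by simp [smul_eq_mul]; ring
        rw [this]
        exact neg_mem hz
      · rintro ⟨q, hq⟩
        obtain ⟨q, rfl⟩ := Submodule.Quotient.mk_surjective _ q
        rw [← hq]
        refine (Submodule.Quotient.mk_eq_zero _).2 ?_
        exact Ideal.mul_mem_right _ _ (X_mem_varIdeal K (by simp))

end VarIdeal

section StanleyReisner

lemma isSES_mapQ_factor {R : Type} [CommRing R] {I P J : Ideal R} {x : R}
    (hP : ∀ r, r * x ∈ I ↔ r ∈ P) (hJ : J = I ⊔ Ideal.span {x}) :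
    IsSES (Submodule.mapQ P I (LinearMap.mulRight R x) fun r hr ↦ (hP r).2 hr)
      (Submodule.factor (hJ ▸ le_sup_left : I ≤ J)) where
  inj := by
    rw [injective_iff_map_eq_zero]
    intro p hp
    obtain ⟨p, rfl⟩ := Submodule.Quotient.mk_surjective _ p
    exact (Submodule.Quotient.mk_eq_zero _).2 ((hP p).1 ((Submodule.Quotient.mk_eq_zero _).1 hp))
  surj := Submodule.factor_surjective _
  exact := by
    intro p
    obtain ⟨p, rfl⟩ := Submodule.Quotient.mk_surjective _ p
    constructor
    · intro h
      have h : p ∈ J := (Submodule.Quotient.mk_eq_zero _).1 h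
      rw [hJ, Submodule.mem_sup] at h
      obtain ⟨y, hy, z, hz, rfl⟩ := h
      obtain ⟨a, rfl⟩ := Ideal.mem_span_singleton'.1 hz
      refine ⟨Submodule.Quotient.mk a, (Submodule.Quotient.eq _).2 ?_⟩
      have : LinearMap.mulRight R x a - (y + a * x) = -y := by simp
      rw [this]
      exact neg_mem hy
    · rintro ⟨q, hq⟩
      obtain ⟨q, rfl⟩ := Submodule.Quotient.mk_surjective _ q
      rw [← hq]
      refine (Submodule.Quotient.mk_eq_zero _).2 ?_
      rw [hJ]
      exact Ideal.mem_sup_right (Ideal.mul_mem_left _ _ (Ideal.mem_span_singleton_self x))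

variable (K : Type) [Field K] {n : ℕ} {Δ : Finset (Finset (Fin n))} {F : Finset (Fin n)}

lemma stanleyReisnerIdeal_le_varIdeal (hΔ : IsSimplicialComplex Δ) (hF : F ∈ Δ) :
    stanleyReisnerIdeal K Δ ≤ varIdeal K Fᶜ := by
  rw [stanleyReisnerIdeal, Ideal.span_le]
  rintro _ ⟨S, hS, rfl⟩
  have : ¬ S ⊆ F := fun h ↦ hS (hΔ F hF S h)
  obtain ⟨i, hi, hiF⟩ := Finset.not_subset.1 this
  exact Ideal.mem_of_dvd _ (Finset.dvd_prod_of_mem _ hi) (X_mem_varIdeal K (by simpa using hiF))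

lemma prod_X_notMem_varIdeal : ∏ i ∈ F, (X i : MvPolynomial (Fin n) K) ∉ varIdeal K Fᶜ := by
  intro h
  obtain ⟨i, hi, hiF⟩ := (Ideal.IsPrime.prod_mem_iff (p := varIdeal K Fᶜ)).1 h
  rw [X_mem_varIdeal_iff] at hiF
  simp_all

lemma mul_prod_X_mem_iff (hΔ : IsSimplicialComplex Δ) (hF : F ∈ Δ)
    (hmax : ∀ j ∉ F, insert j F ∉ Δ) (r : MvPolynomial (Fin n) K) :
    r * ∏ i ∈ F, X i ∈ stanleyReisnerIdeal K Δ ↔ r ∈ varIdeal K Fᶜ := by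
  constructor
  · intro h
    exact ((varIdeal_isPrime K Fᶜ).mem_or_mem
      (stanleyReisnerIdeal_le_varIdeal K hΔ hF h)).resolve_right (prod_X_notMem_varIdeal K)
  · intro h
    rw [varIdeal] at h
    induction h using Submodule.span_induction with
    | mem p hp =>
      obtain ⟨j, hj, rfl⟩ := hp
      have hj : j ∉ F := by simpa using hj
      exact Ideal.subset_span ⟨insert j F, hmax j hj, (Finset.prod_insert hj).symm⟩
    | zero => simp
    | add p q _ _ hp hq => rw [add_mul]; exact add_mem hp hq
    | smul a p _ hp => rw [smul_eq_mul, mul_assoc]; exact Ideal.mul_mem_left _ _ hp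

lemma stanleyReisnerIdeal_erase :
    stanleyReisnerIdeal K (Δ.erase F) =
      stanleyReisnerIdeal K Δ ⊔ Ideal.span {∏ i ∈ F, (X i : MvPolynomial (Fin n) K)} := by
  rw [stanleyReisnerIdeal, stanleyReisnerIdeal, ← Ideal.span_union]
  refine le_antisymm (Ideal.span_le.2 ?_) (Ideal.span_le.2 ?_)
  · rintro _ ⟨S, hS, rfl⟩
    refine Ideal.subset_span ?_
    by_cases h : S = F
    · exact Or.inr (by simp [h])
    · exact Or.inl ⟨S, fun h' ↦ hS (Finset.mem_erase.2 ⟨h, h'⟩), rfl⟩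
  · rintro _ (⟨S, hS, rfl⟩ | h)
    · exact Ideal.subset_span ⟨S, fun h ↦ hS (Finset.mem_of_mem_erase h), rfl⟩
    · exact Ideal.subset_span ⟨F, Finset.notMem_erase _ _, by simpa using h⟩

/-- `Ext^i(K[Δ], R)` vanishes below the codimension. -/
lemma ext_stanleyReisner_subsingleton (d : ℕ) (Δ : Finset (Finset (Fin n)))
    (hΔ : IsSimplicialComplex Δ) (hd : ∀ s ∈ Δ, s.card ≤ d) (i : ℕ) (hi : i + d < n) :
    Subsingleton (ExtM (MvPolynomial (Fin n) K)
      (MvPolynomial (Fin n) K ⧸ stanleyReisnerIdeal K Δ) (MvPolynomial (Fin n) K) i) := by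
  induction h : Δ.card generalizing Δ with
  | zero =>
    obtain rfl := Finset.card_eq_zero.1 h
    have htop : stanleyReisnerIdeal K (∅ : Finset (Finset (Fin n))) = ⊤ := by
      rw [Ideal.eq_top_iff_one]
      exact Ideal.subset_span ⟨∅, by simp, by simp⟩
    have : Subsingleton (MvPolynomial (Fin n) K ⧸
        stanleyReisnerIdeal K (∅ : Finset (Finset (Fin n)))) :=
      Submodule.Quotient.subsingleton_iff.2 htop
    exact (pdLT_zero_of_subsingleton).ext_subsingleton (Nat.zero_le i) _
  | succ k ih =>
    obtain ⟨F, hF, hFmax⟩ := Δ.exists_max_image Finset.card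
      (Finset.card_pos.1 (by lia))
    have hmax : ∀ j ∉ F, insert j F ∉ Δ := by
      intro j hj hjF
      have := hFmax _ hjF
      rw [Finset.card_insert_of_notMem hj] at this
      lia
    have hs := isSES_mapQ_factor (mul_prod_X_mem_iff K hΔ hF hmax)
      (stanleyReisnerIdeal_erase K (Δ := Δ) (F := F))
    have := ih (Δ.erase F) (fun s hs t ht ↦ by
      rw [Finset.mem_erase] at hs ⊢
      refine ⟨?_, hΔ s hs.2 t ht⟩
      rintro rfl
      exact hs.1 (Finset.eq_of_subset_of_card_le ht (hFmax _ hs.2)).symm)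
      (fun s hs ↦ hd s (Finset.mem_of_mem_erase hs)) (by rw [Finset.card_erase_of_mem hF]; lia)
    have hFd := hd F hF
    have := (selfDualExt_varIdeal K Fᶜ).vanish i (by
      rw [Finset.card_compl, Fintype.card_fin]; lia)
    exact subsingleton_of_exact (hs.exact_pre_pre i)

lemma annihilator_ext_le (hΔ : IsSimplicialComplex Δ) (hF : F ∈ Δ)
    (hmax : ∀ j ∉ F, insert j F ∉ Δ) :
    Module.annihilator (MvPolynomial (Fin n) K) (ExtM (MvPolynomial (Fin n) K)
      (MvPolynomial (Fin n) K ⧸ stanleyReisnerIdeal K Δ) (MvPolynomial (Fin n) K) Fᶜ.card) ≤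
      varIdeal K Fᶜ := by
  have hP := mul_prod_X_mem_iff K hΔ hF hmax
  set x := ∏ i ∈ F, (X i : MvPolynomial (Fin n) K) with hx
  let f := Submodule.mapQ (varIdeal K Fᶜ) (stanleyReisnerIdeal K Δ)
    (LinearMap.mulRight (MvPolynomial (Fin n) K) x) fun r hr ↦ (hP r).2 hr
  let g := Submodule.factor (stanleyReisnerIdeal_le_varIdeal K hΔ hF)
  have hgf : g ∘ₗ f = x • LinearMap.id := by
    ext
    refine congrArg (Submodule.Quotient.mk (p := varIdeal K Fᶜ)) ?_
    simp
  have hse := selfDualExt_varIdeal K Fᶜ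
  have hinj : Function.Injective (extPre (MvPolynomial (Fin n) K) Fᶜ.card g) := by
    have := hse.smul_injective (r := x) (by
      rw [injective_iff_map_eq_zero]
      intro p hp
      obtain ⟨p, rfl⟩ := Submodule.Quotient.mk_surjective _ p
      have h : x * p ∈ varIdeal K Fᶜ := (Submodule.Quotient.mk_eq_zero _).1 hp
      exact (Submodule.Quotient.mk_eq_zero _).2
        (((varIdeal_isPrime K Fᶜ).mem_or_mem h).resolve_left (prod_X_notMem_varIdeal K))) Fᶜ.card
    rw [← hgf] at this
    intro a b hab
    apply this
    rw [extPre_comp, extPre_comp, hab]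
  refine (LinearMap.annihilator_le_of_injective _ hinj).trans ?_
  obtain ⟨e⟩ := hse.iso
  rw [e.annihilator_eq, Ideal.annihilator_quotient]

lemma le_annihilator_ext {R : Type} [CommRing R] (I : Ideal R) (L : Type) [AddCommGroup L]
    [Module R L] (i : ℕ) : I ≤ Module.annihilator R (ExtM R (R ⧸ I) L i) := by
  intro a ha
  rw [Module.mem_annihilator]
  intro m
  have : a • (LinearMap.id : (R ⧸ I) →ₗ[R] (R ⧸ I)) = 0 := by
    ext
    refine (Submodule.Quotient.mk_eq_zero _).2 ?_
    simpa using ha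
  rw [← extPre_smul_id, this, extPre_zero]

lemma exists_varIdeal_le {p : Ideal (MvPolynomial (Fin n) K)} [p.IsPrime]
    (hp : stanleyReisnerIdeal K Δ ≤ p) : ∃ G ∈ Δ, varIdeal K Gᶜ ≤ p := by
  classical
  refine ⟨Finset.univ.filter fun i ↦ X i ∉ p, ?_, ?_⟩
  · by_contra h
    have := hp (Ideal.subset_span ⟨_, h, rfl⟩)
    obtain ⟨i, hi, hip⟩ := Ideal.IsPrime.prod_mem_iff.1 this
    simp_all
  · rw [varIdeal, Ideal.span_le]
    rintro _ ⟨i, hi, rfl⟩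
    simpa using hi

lemma ringKrullDim_stanleyReisner_le {d : ℕ} (hd : ∀ s ∈ Δ, s.card ≤ d) :
    ringKrullDim (MvPolynomial (Fin n) K ⧸ stanleyReisnerIdeal K Δ) ≤ d := by
  rw [ringKrullDim_quotient]
  refine iSup_le fun l ↦ ?_
  have hprime := l.head.1.isPrime
  obtain ⟨G, hG, hGp⟩ := exists_varIdeal_le K (p := l.head.1.asIdeal) l.head.2
  let l' : LTSeries (PrimeSpectrum.zeroLocus (R := MvPolynomial (Fin n) K) (varIdeal K Gᶜ)) :=
    { length := l.length
      toFun := fun i ↦ ⟨(l i).1, hGp.trans (l.head_le i)⟩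
      step := fun i ↦ l.step i }
  have h1 : (l.length : WithBot ℕ∞) ≤
      ringKrullDim (MvPolynomial (Fin n) K ⧸ varIdeal K Gᶜ) := by
    rw [ringKrullDim_quotient]
    exact le_iSup (fun p : LTSeries _ ↦ (p.length : WithBot ℕ∞)) l'
  refine h1.trans ?_
  rw [ringKrullDim_quotient_varIdeal, Finset.card_compl, Fintype.card_fin]
  have := hd G hG
  have hle := G.card_le_univ
  rw [Fintype.card_fin] at hle
  exact_mod_cast (by lia : n - (n - G.card) ≤ d)

/-- The top-dimensional deficiency module of `K[Δ]` has the dimension of `K[Δ]`. -/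
lemma moduleDim_ext (hΔ : IsSimplicialComplex Δ) (hd : ∀ s ∈ Δ, s.card ≤ F.card) (hF : F ∈ Δ) :
    moduleDim (MvPolynomial (Fin n) K) (ExtM (MvPolynomial (Fin n) K)
      (MvPolynomial (Fin n) K ⧸ stanleyReisnerIdeal K Δ) (MvPolynomial (Fin n) K) Fᶜ.card) =
      F.card := by
  have hmax : ∀ j ∉ F, insert j F ∉ Δ := by
    intro j hj hjF
    have := hd _ hjF
    rw [Finset.card_insert_of_notMem hj] at this
    lia
  refine le_antisymm ?_ ?_
  · exact (ringKrullDim_le_of_surjective (Ideal.Quotient.factor (le_annihilator_ext _ _ _))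
      (Ideal.Quotient.factor_surjective _)).trans (ringKrullDim_stanleyReisner_le K hd)
  · refine le_trans (le_of_eq ?_) (ringKrullDim_le_of_surjective
      (Ideal.Quotient.factor (annihilator_ext_le K hΔ hF hmax))
      (Ideal.Quotient.factor_surjective _))
    have hle := F.card_le_univ
    rw [Fintype.card_fin] at hle
    rw [ringKrullDim_quotient_varIdeal, Finset.card_compl, Fintype.card_fin]
    rw [Nat.sub_sub_self hle]
    rfl

end StanleyReisner

section Depth

open RingTheory.Sequence Pointwise

variable {R : Type} [CommRing R]

lemma isSES_quotSMulTop {N : Type} [AddCommGroup N] [Module R N] {r : R} (hr : IsSMulRegular N r) :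
    IsSES (r • (LinearMap.id : N →ₗ[R] N)) (r • (⊤ : Submodule R N)).mkQ where
  inj := hr
  surj := Submodule.mkQ_surjective _
  exact := by
    intro x
    rw [Submodule.mkQ_apply, Submodule.Quotient.mk_eq_zero, Submodule.mem_smul_pointwise_iff_exists]
    simp

/-- The length of a regular sequence on a finite module is at most the dimension of the module. -/
lemma length_le_supportDim [IsNoetherianRing R] (rs : List R) (N : Type) [AddCommGroup N]
    [Module R N] [Module.Finite R N] (h : IsRegular N rs) :
    (rs.length : WithBot ℕ∞) ≤ Module.supportDim R N := by
  induction rs generalizing N with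
  | nil =>
    have : Nontrivial N := h.nontrivial
    have : Nonempty (Module.support R N) := Module.nonempty_support_of_nontrivial.to_subtype
    exact Order.krullDim_nonneg
  | cons r rs ih =>
    rw [isRegular_cons_iff] at h
    refine le_trans ?_ (Module.supportDim_quotSMulTop_succ_le_of_notMem_minimalPrimes
      fun _ ↦ h.1.notMem_of_mem_minimalPrimes)
    rw [List.length_cons, Nat.cast_succ]
    exact add_le_add_left (ih _ h.2) 1

lemma moduleDepth_le [IsNoetherianRing R] (I : Ideal R) (N : Type) [AddCommGroup N]
    [Module R N] [Module.Finite R N] {d : ℕ} (hd : moduleDim R N = d) :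
    moduleDepth I N ≤ d := by
  refine sSup_le ?_
  rintro _ ⟨rs, rfl, -, hrs⟩
  have := length_le_supportDim rs N hrs
  rw [Module.supportDim_eq_ringKrullDim_quotient_annihilator] at this
  exact WithBot.coe_le_coe.1 (this.trans_eq hd)

/-- A finite module of positive dimension `d` is Cohen-Macaulay if and only if it admits a
regular sequence of length `d`. -/
lemma isCMMod_iff_exists_isRegular [IsNoetherianRing R] (I : Ideal R) (N : Type) [AddCommGroup N]
    [Module R N] [Module.Finite R N] {d : ℕ} (hd : moduleDim R N = (d + 1 : ℕ)) :
    IsCMMod I N ↔ ∃ rs : List R, rs.length = d + 1 ∧ (∀ r ∈ rs, r ∈ I) ∧ IsRegular N rs := by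
  have hle := moduleDepth_le I N hd
  have hiff : IsCMMod I N ↔ moduleDepth I N = (d + 1 : ℕ) := by
    rw [IsCMMod, hd]
    exact WithBot.coe_inj
  rw [hiff]
  constructor
  · intro h
    have hlt : (d : ℕ∞) < moduleDepth I N := by
      rw [h]
      exact Nat.cast_lt.2 d.lt_succ_self
    obtain ⟨_, ⟨rs, rfl, hI, hrs⟩, hm⟩ := lt_sSup_iff.1 hlt
    refine ⟨rs, le_antisymm ?_ (Nat.cast_lt.1 hm), hI, hrs⟩
    have : (rs.length : ℕ∞) ≤ moduleDepth I N := le_sSup ⟨rs, rfl, hI, hrs⟩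
    exact Nat.cast_le.1 (this.trans_eq h)
  · rintro ⟨rs, hlen, hI, hrs⟩
    exact le_antisymm hle (le_sSup ⟨rs, by rw [hlen], hI, hrs⟩)

/-- A regular sequence of length `t` forces the modules `Ext^i(N, R)` with `i > m - t` to vanish
locally at `I`, where `m` is the global dimension. -/
lemma exists_smul_ext_eq_zero [IsNoetherianRing R] (I : Ideal R) (m : ℕ)
    (hgl : ∀ (N : Type) [AddCommGroup N] [Module R N], PdLT R N (m + 1))
    (rs : List R) (hI : ∀ r ∈ rs, r ∈ I) (N : Type) [AddCommGroup N] [Module R N]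
    [Module.Finite R N] (h : IsWeaklyRegular N rs) (i : ℕ) (hi : m + 1 ≤ i + rs.length) :
    ∃ s : R, s - 1 ∈ I ∧ ∀ x : ExtM R N R i, s • x = 0 := by
  induction rs generalizing N i with
  | nil =>
    have := (hgl N).ext_subsingleton (i := i) (by simpa using hi) R
    exact ⟨1, by simp, fun x ↦ Subsingleton.elim _ _⟩
  | cons r rs ih =>
    rw [isWeaklyRegular_cons_iff] at h
    have hr : r ∈ I := hI r (by simp)
    obtain ⟨s, hs, hsx⟩ := ih (fun r hr ↦ hI r (by simp [hr])) (QuotSMulTop r N) h.2 (i + 1)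
      (by rw [List.length_cons] at hi; lia)
    have hses := isSES_quotSMulTop h.1
    obtain ⟨t, ht, htx⟩ := Submodule.exists_sub_one_mem_and_smul_eq_zero_of_fg_of_le_smul I
      (⊤ : Submodule R (ExtM R N R i)) (Module.Finite.fg_top) (by
        intro x _
        obtain ⟨y, hy⟩ := (hses.exact_pre_δ (L := R) i (s • x)).1 (by rw [map_smul]; exact hsx _)
        rw [extPre_smul_id] at hy
        have hx : x = (1 - s) • x + r • y := by rw [hy, sub_smul, one_smul, sub_add_cancel]
        rw [hx]
        refine add_mem (Submodule.smul_mem_smul ?_ trivial) (Submodule.smul_mem_smul hr trivial)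
        simpa using neg_mem hs)
    exact ⟨t, ht, fun x ↦ htx x trivial⟩

end Depth

section MainEquivalence

open RingTheory.Sequence

variable (K : Type) [Field K] {n : ℕ}

lemma maxIdeal_isPrime : (maxIdeal K n).IsPrime := by
  rw [maxIdeal_eq_varIdeal]
  infer_instance

/-- If `N` has projective dimension at most `n - d` then it has depth at least `d`. -/
lemma exists_isRegular_of_pdLT (N : Type) [AddCommGroup N] [Module (MvPolynomial (Fin n) K) N]
    [Module.Finite (MvPolynomial (Fin n) K) N] (d m : ℕ) (hdm : d + m ≤ n + 1)
    (hpd : PdLT (MvPolynomial (Fin n) K) N m)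
    (hann : Module.annihilator (MvPolynomial (Fin n) K) N ≤ maxIdeal K n) :
    ∃ rs : List (MvPolynomial (Fin n) K), rs.length = d ∧ (∀ r ∈ rs, r ∈ maxIdeal K n) ∧
      IsRegular N rs := by
  refine ModuleCat.exists_isRegular_of_exists_subsingleton_ext (maxIdeal K n) d
    (ModuleCat.of _ N) ?_ (ModuleCat.of _ (MvPolynomial (Fin n) K ⧸ maxIdeal K n)) ?_ ?_
  · rw [lt_top_iff_ne_top]
    intro h
    obtain ⟨s, hs, hsx⟩ := Submodule.exists_sub_one_mem_and_smul_eq_zero_of_fg_of_le_smul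
      (maxIdeal K n) (⊤ : Submodule (MvPolynomial (Fin n) K) N) Module.Finite.fg_top h.ge
    have : s ∈ maxIdeal K n := hann (Module.mem_annihilator.2 fun x ↦ hsx x trivial)
    have h1 : (1 : MvPolynomial (Fin n) K) ∈ maxIdeal K n := by
      simpa using sub_mem this hs
    exact (maxIdeal_isPrime K).ne_top ((Ideal.eq_top_iff_one _).2 h1)
  · rw [Module.support_eq_zeroLocus]
    exact congrArg _ (congrArg _ Ideal.annihilator_quotient)
  · intro i hi
    have hK := selfDualExt_varIdeal K (Finset.univ : Finset (Fin n))
    rw [Finset.card_univ, Fintype.card_fin, ← maxIdeal_eq_varIdeal] at hK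
    exact ext_subsingleton_of_pdLT _ n (fun j hj ↦ hK.vanish j hj.ne) m N hpd i (by lia)

end MainEquivalence

section BaseChange

open TensorProduct

variable {R : Type} [CommRing R]
variable {A B C A' B' C' L : Type} [AddCommGroup A] [Module R A] [AddCommGroup B] [Module R B]
  [AddCommGroup C] [Module R C] [AddCommGroup A'] [Module R A'] [AddCommGroup B'] [Module R B']
  [AddCommGroup C'] [Module R C'] [AddCommGroup L] [Module R L]

/-- The first extension module as the cokernel of a map of modules of homomorphisms. -/
noncomputable def IsSES.homδ {f : A →ₗ[R] B} {g : B →ₗ[R] C} (h : IsSES f g) (L : Type)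
    [AddCommGroup L] [Module R L] : (A →ₗ[R] L) →ₗ[R] ExtM R C L 1 :=
  h.δ L 0 ∘ₗ extZeroEquiv.symm.toLinearMap

lemma IsSES.homδ_surjective {f : A →ₗ[R] B} {g : B →ₗ[R] C} (h : IsSES f g)
    [Module.Projective R B] : Function.Surjective (h.homδ L) := by
  have := ext_subsingleton_of_projective (R := R) (A := B) (L := L) 0
  intro x
  obtain ⟨y, rfl⟩ := (h.exact_δ_pre (L := L) 0 x).1 (Subsingleton.elim _ _)
  exact ⟨extZeroEquiv y, congrArg (h.δ L 0) (extZeroEquiv.symm_apply_apply y)⟩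

lemma IsSES.exact_lcomp_homδ {f : A →ₗ[R] B} {g : B →ₗ[R] C} (h : IsSES f g) :
    Function.Exact (LinearMap.lcomp R L f) (h.homδ L) := by
  intro x
  refine (h.exact_pre_δ (L := L) 0 (extZeroEquiv.symm x)).trans ?_
  constructor
  · rintro ⟨y, hy⟩
    refine ⟨extZeroEquiv y, ?_⟩
    have := congrArg extZeroEquiv hy
    rw [extZeroEquiv_extPre, LinearEquiv.apply_symm_apply] at this
    exact this
  · rintro ⟨y, rfl⟩
    refine ⟨extZeroEquiv.symm y, ?_⟩
    apply extZeroEquiv.injective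
    rw [extZeroEquiv_extPre, LinearEquiv.apply_symm_apply, LinearEquiv.apply_symm_apply]
    rfl

lemma nonempty_equiv_of_exact {f : A →ₗ[R] B} {g : B →ₗ[R] C} {f' : A' →ₗ[R] B'}
    {g' : B' →ₗ[R] C'} (h : Function.Exact f g) (hg : Function.Surjective g)
    (h' : Function.Exact f' g') (hg' : Function.Surjective g') (a : A ≃ₗ[R] A') (b : B ≃ₗ[R] B')
    (hab : ∀ x, b (f x) = f' (a x)) : Nonempty (C ≃ₗ[R] C') := by
  refine nonempty_equiv_of_ker_eq (f := g) (g := g' ∘ₗ b.toLinearMap) hg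
    (hg'.comp b.surjective) ?_
  ext x
  rw [LinearMap.mem_ker, LinearMap.mem_ker, h x, LinearMap.comp_apply, LinearEquiv.coe_coe,
    h' (b x)]
  constructor
  · rintro ⟨y, rfl⟩
    exact ⟨a y, (hab y).symm⟩
  · rintro ⟨y, hy⟩
    obtain ⟨y, rfl⟩ := a.surjective y
    exact ⟨y, b.injective ((hab y).trans hy)⟩

variable (S : Type) [CommRing S] [Algebra R S] [Module.Flat R S]

/-- `Hom` out of a finitely presented module commutes with flat base change. -/
noncomputable def homBaseChange [Module.FinitePresentation R A] :
    S ⊗[R] (A →ₗ[R] L) ≃ₗ[S] (S ⊗[R] A →ₗ[S] S ⊗[R] L) :=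
  (Module.FinitePresentation.isBaseChange_map R A L S).equiv

lemma homBaseChange_tmul [Module.FinitePresentation R A] (s : S) (φ : A →ₗ[R] L) :
    homBaseChange S (s ⊗ₜ[R] φ) = s • φ.baseChange S :=
  (Module.FinitePresentation.isBaseChange_map R A L S).equiv_tmul s φ

/-- `Ext` out of a finite module commutes with flat base change. -/
lemma nonempty_ext_baseChange [IsNoetherianRing R] (L : Type) [AddCommGroup L] [Module R L] (i : ℕ)
    (N : Type) [AddCommGroup N] [Module R N] [Module.Finite R N] :
    Nonempty (S ⊗[R] ExtM R N L i ≃ₗ[S] ExtM S (S ⊗[R] N) (S ⊗[R] L) i) := by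
  induction i generalizing N with
  | zero =>
    have := Module.finitePresentation_of_finite R N
    exact ⟨(extZeroEquiv.baseChange R S _ _).trans ((homBaseChange S).trans extZeroEquiv.symm)⟩
  | succ i ih =>
    obtain ⟨k, p, hp⟩ := Module.Finite.exists_fin' R N
    have hs := isSES_ker hp
    have hS := hs.baseChange S
    have hfin : Module.Finite R (LinearMap.ker p) := inferInstance
    cases i with
    | zero =>
      have := Module.finitePresentation_of_finite R (LinearMap.ker p)
      have h₁ : Function.Exact ((LinearMap.lcomp R L (LinearMap.ker p).subtype).baseChange S)
          ((hs.homδ L).baseChange S) := lTensor_exact S hs.exact_lcomp_homδ hs.homδ_surjective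
      have h₂ : Function.Surjective ((hs.homδ L).baseChange S) :=
        LinearMap.lTensor_surjective S hs.homδ_surjective
      have h₃ := hS.exact_lcomp_homδ (L := S ⊗[R] L)
      have h₄ := hS.homδ_surjective (L := S ⊗[R] L)
      let a : S ⊗[R] ((Fin k → R) →ₗ[R] L) ≃ₗ[S] _ := homBaseChange S
      let b : S ⊗[R] (LinearMap.ker p →ₗ[R] L) ≃ₗ[S] _ := homBaseChange S
      refine nonempty_equiv_of_exact (A' := S ⊗[R] (Fin k → R) →ₗ[S] S ⊗[R] L)
        (B' := S ⊗[R] LinearMap.ker p →ₗ[S] S ⊗[R] L) h₁ h₂ h₃ h₄ a b ?_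
      intro x
      induction x with
      | zero => simp
      | add x y hx hy => simp only [map_add, hx, hy]
      | tmul s φ =>
        rw [LinearMap.baseChange_tmul, homBaseChange_tmul, homBaseChange_tmul, map_smul]
        congr 1
        ext
        simp
    | succ i =>
      obtain ⟨e⟩ := hs.ext_equiv_of_subsingleton (L := L) (i + 1)
        (ext_subsingleton_of_projective i) (ext_subsingleton_of_projective (i + 1))
      obtain ⟨e'⟩ := hS.ext_equiv_of_subsingleton (L := S ⊗[R] L) (i + 1)
        (ext_subsingleton_of_projective i) (ext_subsingleton_of_projective (i + 1))
      obtain ⟨e''⟩ := ih (LinearMap.ker p)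
      exact ⟨(e.symm.baseChange R S _ _).trans (e''.trans e')⟩

end BaseChange

section Equivariance

open TensorProduct

variable {R S : Type} [CommRing R] [CommRing S]

/-- Extension of scalars along a ring homomorphism. -/
noncomputable def ScalarExt (f : R →+* S) (N : Type) [AddCommGroup N] [Module R N] : ModuleCat S :=
  let _ := f.toAlgebra
  ModuleCat.of S (S ⊗[R] N)

/-- Two extensions of scalars of a module are isomorphic. For the coaction `f` of a torus on `R` and
the inclusion `g`, this is a weak form of equivariance. -/
abbrev ScalarExtIso (f g : R →+* S) (N : Type) [AddCommGroup N] [Module R N] : Prop :=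
  Nonempty (ScalarExt f N ≃ₗ[S] ScalarExt g N)

lemma nonempty_ext_scalarExt [IsNoetherianRing R] {f : R →+* S} (hf : f.Flat) (i : ℕ) (N : Type)
    [AddCommGroup N] [Module R N] [Module.Finite R N] :
    Nonempty (ScalarExt f (ExtM R N R i) ≃ₗ[S] ExtM S (ScalarExt f N) S i) := by
  let _ := f.toAlgebra
  have : Module.Flat R S := hf
  obtain ⟨e⟩ := nonempty_ext_baseChange (R := R) S R i N
  exact ⟨e.trans (extCongrRight i (AlgebraTensorModule.rid R S S))⟩

lemma ScalarExtIso.ext [IsNoetherianRing R] {f g : R →+* S} (hf : f.Flat) (hg : g.Flat) {N : Type}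
    [AddCommGroup N] [Module R N] [Module.Finite R N] (h : ScalarExtIso f g N) (i : ℕ) :
    ScalarExtIso f g (ExtM R N R i) := by
  obtain ⟨e⟩ := h
  obtain ⟨e₁⟩ := nonempty_ext_scalarExt hf i N
  obtain ⟨e₂⟩ := nonempty_ext_scalarExt hg i N
  exact ⟨e₁.trans ((extCongrLeft i e.symm).trans e₂.symm)⟩

lemma nonempty_scalarExt_quotient (f : R →+* S) (I : Ideal R) :
    Nonempty (ScalarExt f (R ⧸ I) ≃ₗ[S] S ⧸ I.map f) := by
  let _ := f.toAlgebra
  exact ⟨(Algebra.TensorProduct.quotIdealMapEquivTensorQuot S I).symm.toLinearEquiv⟩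

lemma scalarExtIso_quotient {f g : R →+* S} {I : Ideal R} (h : I.map f = I.map g) :
    ScalarExtIso f g (R ⧸ I) := by
  obtain ⟨e₁⟩ := nonempty_scalarExt_quotient f I
  obtain ⟨e₂⟩ := nonempty_scalarExt_quotient g I
  exact ⟨e₁.trans ((Submodule.quotEquivOfEq _ _ h).trans e₂.symm)⟩

/-- If `s` annihilates `N`, then so do the coefficients of `f s`. -/
lemma ScalarExtIso.smul_eq_zero {f g : R →+* S} {N : Type} [AddCommGroup N] [Module R N]
    (h : ScalarExtIso f g N) (ε : S →+ R) (hε : ∀ r x, ε (g r * x) = r * ε x) {s : R}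
    (hs : ∀ x : N, s • x = 0) (x : N) : ε (f s) • x = 0 := by
  obtain ⟨e⟩ := h
  have hf : ∀ y : ScalarExt f N, f s • y = 0 := by
    let _ := f.toAlgebra
    intro (y : S ⊗[R] N)
    change f s • y = 0
    induction y with
    | zero => simp
    | add a b ha hb => rw [smul_add, ha, hb, add_zero]
    | tmul a b =>
      have : f s • a ⊗ₜ[R] b = a ⊗ₜ[R] (s • b) := by
        rw [TensorProduct.tmul_smul, TensorProduct.smul_tmul', TensorProduct.smul_tmul']
        rfl
      rw [this, hs, tmul_zero]
  have hg : ∀ y : ScalarExt g N, f s • y = 0 := by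
    intro y
    obtain ⟨y, rfl⟩ := e.surjective y
    rw [← map_smul, hf, map_zero]
  let _ := g.toAlgebra
  let εl : S →ₗ[R] R := { ε with map_smul' := hε }
  have h1 : f s • ((1 : S) ⊗ₜ[R] x) = 0 := hg _
  have := congrArg (TensorProduct.lid R N ∘ εl.rTensor N) h1
  simpa [TensorProduct.smul_tmul', εl] using this

end Equivariance

section Laurent

open LaurentPolynomial

variable (K : Type) [Field K] (n : ℕ)

/-- The coaction of the torus raised to the power `m`: `x_i ↦ x_i T ^ m`. -/
noncomputable def coaction (m : ℤ) :
    MvPolynomial (Fin n) K →ₐ[K] LaurentPolynomial (MvPolynomial (Fin n) K) :=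
  aeval fun i ↦ LaurentPolynomial.C (X i) * T m

/-- The Laurent polynomial variable as a unit. -/
noncomputable def unitT (R : Type) [CommRing R] : (LaurentPolynomial R)ˣ where
  val := T 1
  inv := T (-1)
  val_inv := by rw [← T_add]; simp
  inv_val := by rw [← T_add]; simp

lemma unitT_zpow (R : Type) [CommRing R] (m : ℤ) : ((unitT R ^ m : (LaurentPolynomial R)ˣ) :
    LaurentPolynomial R) = T m := by
  cases m with
  | ofNat m => simp [unitT, T_pow]
  | negSucc m =>
    rw [zpow_negSucc, ← inv_pow]
    simp [unitT, T_pow, Int.negSucc_eq]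

/-- The endomorphism of the ring of Laurent polynomials extending the coaction. -/
noncomputable def coactionExt (m : ℤ) :
    LaurentPolynomial (MvPolynomial (Fin n) K) →+* LaurentPolynomial (MvPolynomial (Fin n) K) :=
  eval₂ (coaction K n m : _ →+* _) (unitT _)

lemma coactionExt_T (m k : ℤ) : coactionExt K n m (T k) = T k := by
  rw [coactionExt, eval₂_T, unitT_zpow]

lemma coactionExt_comp_C (m : ℤ) :
    (coactionExt K n m).comp LaurentPolynomial.C = (coaction K n m : MvPolynomial (Fin n) K →+* _) := by
  exact RingHom.ext fun p ↦ eval₂_C _ _ _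

lemma coactionExt_comp_coaction (m k : ℤ) :
    (coactionExt K n m).comp (coaction K n k : MvPolynomial (Fin n) K →+* _) =
      (coaction K n (m + k) : MvPolynomial (Fin n) K →+* _) := by
  refine MvPolynomial.ringHom_ext (fun a ↦ ?_) (fun i ↦ ?_)
  · have h : ∀ k, coaction K n k (MvPolynomial.C a) =
        LaurentPolynomial.C (MvPolynomial.C a) := fun k ↦ by
      rw [← MvPolynomial.algebraMap_eq, AlgHom.commutes]; rfl
    simp only [RingHom.comp_apply, RingHom.coe_coe, h]
    rw [← RingHom.comp_apply, coactionExt_comp_C]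
    exact h m
  · have h : ∀ k, coaction K n k (X i) = LaurentPolynomial.C (X i) * T k := fun k ↦ by simp [coaction]
    simp only [RingHom.comp_apply, RingHom.coe_coe, h, map_mul, coactionExt_T]
    rw [← RingHom.comp_apply, coactionExt_comp_C, RingHom.coe_coe, h, mul_assoc, ← T_add]

lemma coaction_zero : (coaction K n 0 : MvPolynomial (Fin n) K →+*
    LaurentPolynomial (MvPolynomial (Fin n) K)) = LaurentPolynomial.C := by
  refine MvPolynomial.ringHom_ext (fun a ↦ ?_) (fun i ↦ ?_)
  · rw [RingHom.coe_coe, ← MvPolynomial.algebraMap_eq, AlgHom.commutes]; rfl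
  · simp [coaction]

lemma coactionExt_leftInverse {m k : ℤ} (h : m + k = 0) :
    Function.LeftInverse (coactionExt K n m) (coactionExt K n k) := by
  intro p
  induction p using LaurentPolynomial.induction_on' with
  | add p q hp hq => rw [map_add, map_add, hp, hq]
  | C_mul_T j a =>
    rw [map_mul, map_mul, coactionExt_T, coactionExt_T, ← RingHom.comp_apply (coactionExt K n k),
      coactionExt_comp_C, ← RingHom.comp_apply, coactionExt_comp_coaction, h, coaction_zero]

lemma flat_C (R : Type) [CommRing R] : (LaurentPolynomial.C : R →+* LaurentPolynomial R).Flat := by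
  have : (LaurentPolynomial.C : R →+* LaurentPolynomial R) = algebraMap R _ := rfl
  rw [this, RingHom.flat_algebraMap_iff]
  infer_instance

lemma flat_coaction : (coaction K n 1 : MvPolynomial (Fin n) K →+*
    LaurentPolynomial (MvPolynomial (Fin n) K)).Flat := by
  rw [← coactionExt_comp_C]
  exact (flat_C _).comp (RingHom.Flat.of_bijective
    (Function.bijective_iff_has_inverse.2 ⟨coactionExt K n (-1),
      coactionExt_leftInverse K n (by simp), coactionExt_leftInverse K n (by simp)⟩))

end Laurent

section Homogeneity

open LaurentPolynomial

variable (K : Type) [Field K] {n : ℕ}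

lemma coaction_X (m : ℤ) (i : Fin n) : coaction K n m (X i) = LaurentPolynomial.C (X i) * T m := by
  simp [coaction]

lemma coaction_prod_X (S : Finset (Fin n)) :
    coaction K n 1 (∏ i ∈ S, X i) = LaurentPolynomial.C (∏ i ∈ S, X i) * T S.card := by
  simp [map_prod, coaction_X, Finset.prod_mul_distrib, T_pow]

lemma map_coaction_stanleyReisnerIdeal (Δ : Finset (Finset (Fin n))) :
    (stanleyReisnerIdeal K Δ).map (coaction K n 1 : MvPolynomial (Fin n) K →+*
      LaurentPolynomial (MvPolynomial (Fin n) K)) =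
    (stanleyReisnerIdeal K Δ).map (LaurentPolynomial.C : MvPolynomial (Fin n) K →+*
      LaurentPolynomial (MvPolynomial (Fin n) K)) := by
  have hmem : ∀ S ∉ Δ, (∏ i ∈ S, X i : MvPolynomial (Fin n) K) ∈ stanleyReisnerIdeal K Δ :=
    fun S hS ↦ Ideal.subset_span ⟨S, hS, rfl⟩
  refine le_antisymm ?_ ?_
  · rw [Ideal.map_le_iff_le_comap, stanleyReisnerIdeal, Ideal.span_le]
    rintro _ ⟨S, hS, rfl⟩
    rw [SetLike.mem_coe, Ideal.mem_comap, RingHom.coe_coe, coaction_prod_X]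
    exact Ideal.mul_mem_right _ _ (Ideal.mem_map_of_mem _ (hmem S hS))
  · rw [Ideal.map_le_iff_le_comap]
    conv_lhs => rw [stanleyReisnerIdeal]
    rw [Ideal.span_le]
    rintro _ ⟨S, hS, rfl⟩
    have h : LaurentPolynomial.C (∏ i ∈ S, X i : MvPolynomial (Fin n) K) =
        coaction K n 1 (∏ i ∈ S, X i) * T (-S.card) := by
      rw [coaction_prod_X, mul_assoc, ← T_add]
      simp
    rw [SetLike.mem_coe, Ideal.mem_comap, h]
    exact Ideal.mul_mem_right _ _ (Ideal.mem_map_of_mem _ (hmem S hS))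

/-- The constant coefficient of a Laurent polynomial. -/
noncomputable def coeffZero (R : Type) [CommRing R] : LaurentPolynomial R →ₗ[R] R :=
  Finsupp.lapply (0 : ℤ) ∘ₗ
    (AddMonoidAlgebra.coeffLinearEquiv R : LaurentPolynomial R ≃ₗ[R] ℤ →₀ R)

lemma coeffZero_C_mul_T {R : Type} [CommRing R] (a : R) (m : ℤ) :
    coeffZero R (LaurentPolynomial.C a * T m) = if m = 0 then a else 0 := by
  rw [← single_eq_C_mul_T]
  exact Finsupp.single_apply

lemma coaction_monomial (m : Fin n →₀ ℕ) (a : K) :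
    coaction K n 1 (monomial m a) = LaurentPolynomial.C (monomial m a) * T m.degree := by
  induction m using Finsupp.induction_linear generalizing a with
  | zero =>
    simp only [map_zero, Nat.cast_zero, T_zero, mul_one, ← MvPolynomial.C_apply]
    rw [← MvPolynomial.algebraMap_eq, AlgHom.commutes]
    rfl
  | add f g hf hg =>
    have h : monomial (f + g) a = monomial f a * monomial g 1 := by rw [monomial_mul, mul_one]
    rw [h, map_mul, hf, hg, map_mul, map_add, Nat.cast_add, T_add]
    ring
  | single i k =>
    have h : monomial (Finsupp.single i k) a = MvPolynomial.C a * X i ^ k := by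
      rw [← C_mul_X_pow_eq_monomial]
    rw [h, map_mul, map_pow, coaction_X, ← MvPolynomial.algebraMap_eq, AlgHom.commutes, mul_pow,
      T_pow, map_mul, map_pow, mul_assoc]
    simp

lemma coeffZero_coaction (p : MvPolynomial (Fin n) K) :
    coeffZero _ (coaction K n 1 p) = MvPolynomial.C (constantCoeff p) := by
  induction p using MvPolynomial.induction_on' with
  | monomial m a =>
    rw [coaction_monomial, coeffZero_C_mul_T, constantCoeff_monomial]
    by_cases hm : m = 0
    · simp [hm]
    · simp [hm, Finsupp.degree_eq_zero_iff]
  | add p q hp hq => simp only [map_add, hp, hq]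

/-- A weak form of Nakayama's lemma for graded modules. -/
lemma subsingleton_of_smul_eq_zero {N : Type} [AddCommGroup N] [Module (MvPolynomial (Fin n) K) N]
    (h : ScalarExtIso (coaction K n 1 : MvPolynomial (Fin n) K →+* _) LaurentPolynomial.C N)
    {s : MvPolynomial (Fin n) K} (hs1 : s - 1 ∈ maxIdeal K n) (hs : ∀ x : N, s • x = 0) :
    Subsingleton N := by
  have hconst : constantCoeff s = 1 := by
    have hle : maxIdeal K n ≤ RingHom.ker (constantCoeff : MvPolynomial (Fin n) K →+* K) := by
      rw [maxIdeal, Ideal.span_le]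
      rintro _ ⟨i, rfl⟩
      simp
    have := hle hs1
    rwa [RingHom.mem_ker, map_sub, map_one, sub_eq_zero] at this
  refine subsingleton_of_forall_eq 0 fun x ↦ ?_
  have := h.smul_eq_zero (coeffZero _).toAddMonoidHom (fun r y ↦ by
    rw [← LaurentPolynomial.smul_eq_C_mul]; exact map_smul (coeffZero _) _ _) hs x
  simpa [coeffZero_coaction, hconst] using this

lemma scalarExtIso_ext_ext_stanleyReisner (Δ : Finset (Finset (Fin n))) (i j : ℕ) :
    ScalarExtIso (coaction K n 1 : MvPolynomial (Fin n) K →+* _) LaurentPolynomial.C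
      (ExtM (MvPolynomial (Fin n) K) (ExtM (MvPolynomial (Fin n) K)
        (MvPolynomial (Fin n) K ⧸ stanleyReisnerIdeal K Δ) (MvPolynomial (Fin n) K) i)
        (MvPolynomial (Fin n) K) j) :=
  ((scalarExtIso_quotient (map_coaction_stanleyReisnerIdeal K Δ)).ext (flat_coaction K n)
    (flat_C _) i).ext (flat_coaction K n) (flat_C _) j

end Homogeneity

section Main

variable {R : Type} [CommRing R]

lemma moduleDim_congr {A B : Type} [AddCommGroup A] [Module R A] [AddCommGroup B] [Module R B]
    (e : A ≃ₗ[R] B) : moduleDim R A = moduleDim R B := by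
  rw [moduleDim, moduleDim, e.annihilator_eq]

lemma moduleDepth_congr (I : Ideal R) {A B : Type} [AddCommGroup A] [Module R A] [AddCommGroup B]
    [Module R B] (e : A ≃ₗ[R] B) : moduleDepth I A = moduleDepth I B := by
  simp only [moduleDepth, e.isRegular_congr]

lemma isCMMod_congr (I : Ideal R) {A B : Type} [AddCommGroup A] [Module R A] [AddCommGroup B]
    [Module R B] (e : A ≃ₗ[R] B) : IsCMMod I A ↔ IsCMMod I B := by
  rw [IsCMMod, IsCMMod, moduleDim_congr e, moduleDepth_congr I e]

lemma pdLT_ext_stanleyReisner (K : Type) [Field K] {n : ℕ} {Δ : Finset (Finset (Fin n))}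
    (hΔ : IsSimplicialComplex Δ) (hd : ∀ s ∈ Δ, s.card ≤ 3) (hn : 3 ≤ n) :
    PdLT (MvPolynomial (Fin n) K) (ExtM (MvPolynomial (Fin n) K)
      (MvPolynomial (Fin n) K ⧸ stanleyReisnerIdeal K Δ) (MvPolynomial (Fin n) K) (n - 3))
      (n - 2 + 1) := by
  have hdual : ∀ (W : Type) [AddCommGroup W] [Module (MvPolynomial (Fin n) K) W]
      [Module.Finite (MvPolynomial (Fin n) K) W],
      PdLT (MvPolynomial (Fin n) K) (W →ₗ[MvPolynomial (Fin n) K] MvPolynomial (Fin n) K)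
        (n - 2 + 1) := fun W _ _ _ ↦
    pdLT_dual (by omega) fun N _ _ ↦ by
      rw [show n - 2 + 1 + 2 = n + 1 by omega]
      exact pdLT_mvPolynomial K n N
  obtain hn | hn := hn.eq_or_lt
  · subst hn
    exact (hdual (MvPolynomial (Fin 3) K ⧸ stanleyReisnerIdeal K Δ)).congr extZeroEquiv.symm
  · have h := ext_stanleyReisner_subsingleton K 3 Δ hΔ hd
    obtain ⟨c, rfl⟩ : ∃ c, n = c + 4 := ⟨n - 4, by omega⟩
    have h0 := h 0 (by omega)
    exact (pdLT_ext (fun W _ _ _ ↦ hdual W) c 0 _ (pdLT_zero_of_subsingleton)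
      fun i hi ↦ h (i + 1) (by omega)).mono (by omega)

end Main

end CanonicalCM

open CanonicalCM

/-- Let `Δ` be a 2-dimensional simplicial complex on `[n]`.  Then `K[Δ]` is canonically
Cohen–Macaulay iff the Lyubeznik number `λ_{2,3}(K[Δ])` vanishes; by Yanagawa's formula
(and since `Ext^{n−3}_R(K[Δ], ω_R)` satisfies `(S₂)`) this amounts to:
`Ext^{n−3}_R(K[Δ], ω_R)` is Cohen–Macaulay iff
`Ext^{n−2}_R(Ext^{n−3}_R(K[Δ], ω_R), ω_R) = 0`. -/
theorem stanley_reisner_ccm_iff_lyubeznik23_zero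
    (K : Type) [Field K] (n : ℕ) (Δ : Finset (Finset (Fin n)))
    (hΔ : IsSimplicialComplex Δ)
    (hdim : (∀ s ∈ Δ, s.card ≤ 3) ∧ ∃ s ∈ Δ, s.card = 3) :
    IsCMMod (maxIdeal K n)
      (extMod (MvPolynomial (Fin n) K) (n - 3)
        (MvPolynomial (Fin n) K ⧸ stanleyReisnerIdeal K Δ) (MvPolynomial (Fin n) K)) ↔
    Subsingleton
      (extMod (MvPolynomial (Fin n) K) (n - 2)
        (extMod (MvPolynomial (Fin n) K) (n - 3)
          (MvPolynomial (Fin n) K ⧸ stanleyReisnerIdeal K Δ) (MvPolynomial (Fin n) K))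
        (MvPolynomial (Fin n) K)) := by
  obtain ⟨hd, F, hF, hF3⟩ := hdim
  have hn : 3 ≤ n := by simpa [hF3] using F.card_le_univ
  have hFc : n - 3 = Fᶜ.card := by rw [Finset.card_compl, Fintype.card_fin, hF3]
  set R := MvPolynomial (Fin n) K
  set S := R ⧸ stanleyReisnerIdeal K Δ
  let M := ExtM R S R (n - 3)
  let e : extMod R (n - 3) S R ≃ₗ[R] M := extModEquiv S R (n - 3)
  rw [isCMMod_congr _ e, ((extModEquiv _ R (n - 2)).trans
    (extCongrLeft (n - 2) e.symm)).toEquiv.subsingleton_congr]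
  have hpd : PdLT R M (n - 2 + 1) := pdLT_ext_stanleyReisner K hΔ hd hn
  have hdimM : moduleDim R M = (2 + 1 : ℕ) := by
    have := moduleDim_ext K hΔ (hF3 ▸ hd) hF
    rwa [← hFc, hF3] at this
  rw [isCMMod_iff_exists_isRegular _ _ hdimM]
  constructor
  · rintro ⟨rs, hlen, hmem, hreg⟩
    obtain ⟨s, hs1, hs⟩ := exists_smul_ext_eq_zero (maxIdeal K n) n
      (fun N _ _ ↦ pdLT_mvPolynomial K n N) rs hmem M hreg.toIsWeaklyRegular (n - 2) (by omega)
    exact subsingleton_of_smul_eq_zero K (scalarExtIso_ext_ext_stanleyReisner K Δ _ _) hs1 hs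
  · intro h
    refine exists_isRegular_of_pdLT K M 3 (n - 2) (by omega)
      (pdLT_of_ext_subsingleton (n - 2) hpd h) ?_
    rw [maxIdeal_eq_varIdeal]
    refine le_trans ?_ (Ideal.span_mono
      (Set.image_mono (Finset.coe_subset.2 (Finset.subset_univ Fᶜ))))
    have := annihilator_ext_le K hΔ hF fun j hj hins ↦ by
      have := hd _ hins
      rw [Finset.card_insert_of_notMem hj] at this
      omega
    rwa [← hFc] at this
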